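/- arXiv:2202.08140 — 6 statements merged into one kernel-verified Lean document; each statement's English description precedes it below -/
import Mathlib

section
/- Let A be a weakly Rickart C*-algebra and let x ∈ A. Then the annihilating left projection LP(x) and the annihilating right projection RP(x) of x are Murray–von Neumann equivalent in A; that is, there exists a partial isometry e ∈ A with e e* = LP(x) and e* e = RP(x). -/
/-- A projection in a C*-algebra: a self-adjoint idempotent. -/
def IsProjection {A : Type*} [Mul A] [Star A] (p : A) : Prop :=
  star p = p ∧ p * p = p

/-- A partial isometry: an element `e` such that `e * e*` is a projection. -/
def IsPartialIsometry {A : Type*} [Mul A] [Star A] (e : A) : Prop :=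
  IsProjection (e * star e)

/-- `p` is an annihilating right projection (ARP) of `x`. -/
def IsARP {A : Type*} [Mul A] [Star A] (x p : A) [Zero A] : Prop :=
  IsProjection p ∧ x * p = x ∧ ∀ y : A, x * y = 0 → p * y = 0

/-- `q` is an annihilating left projection (ALP) of `x`. -/
def IsALP {A : Type*} [Mul A] [Star A] (x q : A) [Zero A] : Prop :=
  IsProjection q ∧ q * x = x ∧ ∀ y : A, y * x = 0 → y * q = 0

/-- A C*-algebra is weakly Rickart if every element admits an ARP. -/
def WeaklyRickart (A : Type*) [NonUnitalCStarAlgebra A] : Prop :=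
  ∀ x : A, ∃ p : A, IsARP x p

section

variable {A : Type*} [NonUnitalCStarAlgebra A]

theorem eq_zero_of_star_mul_self {a : A} (h : star a * a = 0) : a = 0 :=
  (CStarRing.star_mul_self_eq_zero_iff a).1 h

theorem mul_eq_zero_of_star_mul_self_eq {y h : A} (hyh : star y * y = star h * h) {z : A}
    (hz : h * z = 0) : y * z = 0 := by
  apply eq_zero_of_star_mul_self
  calc star (y * z) * (y * z) = star z * (star y * y) * z := by simp only [star_mul, mul_assoc]
    _ = star z * star h * (h * z) := by rw [hyh]; simp only [mul_assoc]
    _ = 0 := by rw [hz, mul_zero]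

theorem mul_eq_of_forall_mul_eq_zero {x y p : A} (h : ∀ z, x * z = 0 → y * z = 0)
    (hp : x * p = x) : y * p = y := by
  have key : ∀ z, y * (z - p * z) = 0 := fun z => h _ (by rw [mul_sub, ← mul_assoc, hp, sub_self])
  have hy : (y - y * p) * star (y - y * p) = 0 := by
    have h1 := key (star (y - y * p))
    rw [mul_sub, ← mul_assoc, ← sub_mul] at h1
    exact h1
  exact (sub_eq_zero.1 ((CStarRing.mul_star_self_eq_zero_iff _).1 hy)).symm

theorem IsProjection.sub {p q : A} (hp : IsProjection p) (hq : IsProjection q) (h : p * q = q) :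
    IsProjection (p - q) := by
  have h' : q * p = q := by simpa [hp.1, hq.1] using congrArg star h
  refine ⟨by rw [star_sub, hp.1, hq.1], ?_⟩
  rw [mul_sub, sub_mul, sub_mul, hp.2, hq.2, h, h']
  abel

theorem IsProjection.star_mul_eq {p q : A} (hp : IsProjection p) (hq : IsProjection q) {a : A}
    (h : p * q = a) : q * p = star a := by
  rw [← h, star_mul, hp.1, hq.1]

theorem IsARP.commute {f p b : A} (hp : IsARP f p) (hb : IsSelfAdjoint b)
    (h : f * b = b * f) : p * b = b * p := by
  have h1 : p * (b * p - b) = 0 :=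
    hp.2.2 _ (by rw [mul_sub, ← mul_assoc, h, mul_assoc, hp.2.1, sub_self])
  rw [mul_sub, sub_eq_zero, ← mul_assoc] at h1
  have h2 := congrArg star h1
  simp only [star_mul, hp.1.1, hb.star_eq, ← mul_assoc] at h2
  rw [← h1, h2]

theorem IsARP.mul_left_eq {h p : A} (hp : IsARP h p) (hh : IsSelfAdjoint h) : p * h = h := by
  simpa [hp.1.1, hh.star_eq] using congrArg star hp.2.1

theorem IsARP.mul_eq_zero_left {h p z : A} (hp : IsARP h p) (hh : IsSelfAdjoint h)
    (hz : z * h = 0) : z * p = 0 := by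
  have h1 : h * star z = 0 := by simpa [hh.star_eq] using congrArg star hz
  simpa [hp.1.1] using congrArg star (hp.2.2 _ h1)

/-- `s` is the supremum of the projections `e n`. -/
structure IsProjSup (e : ℕ → A) (s : A) : Prop where
  isProjection : IsProjection s
  mul_eq : ∀ n, s * e n = e n
  mul_eq_zero : ∀ z, (∀ n, e n * z = 0) → s * z = 0

theorem IsProjSup.mul_eq_right {e : ℕ → A} {s : A} (hs : IsProjSup e s)
    (he : ∀ n, IsProjection (e n)) (n : ℕ) : e n * s = e n := by
  simpa [hs.isProjection.1, (he n).1] using congrArg star (hs.mul_eq n)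

theorem IsProjSup.eq_zero_left {e : ℕ → A} {s : A} (hs : IsProjSup e s)
    (he : ∀ n, IsProjection (e n)) {z : A} (hz : ∀ n, z * e n = 0) : z * s = 0 := by
  have h1 : ∀ n, e n * star z = 0 := fun n => by simpa [(he n).1] using congrArg star (hz n)
  simpa [hs.isProjection.1] using congrArg star (hs.mul_eq_zero _ h1)

theorem IsProjection.norm_le_one {p : A} (hp : IsProjection p) : ‖p‖ ≤ 1 := by
  have h := CStarRing.norm_star_mul_self (x := p)
  rw [hp.1, hp.2] at h
  nlinarith [norm_nonneg p]

theorem summable_geometric_smul {e : ℕ → A} (he : ∀ n, ‖e n‖ ≤ 1) :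
    Summable fun n => (2⁻¹ : ℝ) ^ n • e n := by
  refine Summable.of_norm_bounded (summable_geometric_of_lt_one (r := (2⁻¹ : ℝ)) (by norm_num)
    (by norm_num)) fun n => ?_
  rw [norm_smul, norm_pow, Real.norm_of_nonneg (by norm_num : (0 : ℝ) ≤ 2⁻¹)]
  exact mul_le_of_le_one_right (by positivity) (he n)

theorem exists_isProjSup (hA : WeaklyRickart A) {e : ℕ → A} (he : ∀ n, IsProjection (e n)) :
    ∃ s, IsProjSup e s := by
  let _ := CStarAlgebra.spectralOrder A
  let _ := CStarAlgebra.spectralOrderedRing A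
  have hsum := summable_geometric_smul fun n => (he n).norm_le_one
  set z : A := ∑' n, (2⁻¹ : ℝ) ^ n • e n with hz
  have hpos : ∀ n, 0 ≤ (2⁻¹ : ℝ) ^ n • e n := fun n => by
    have h0 : 0 ≤ e n := by
      have := star_mul_self_nonneg (e n)
      rwa [(he n).1, (he n).2] at this
    exact smul_nonneg (by positivity) h0
  have hle : ∀ n, (2⁻¹ : ℝ) ^ n • e n ≤ z := fun n => hsum.le_tsum n fun m _ => hpos m
  have hzs : IsSelfAdjoint z := IsSelfAdjoint.of_nonneg (tsum_nonneg hpos)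
  obtain ⟨s, hs⟩ := hA z
  have hann : ∀ y n, z * y = 0 → e n * y = 0 := fun y n hy => by
    have h1 : star y * ((2⁻¹ : ℝ) ^ n • e n) * y ≤ star y * z * y :=
      star_left_conjugate_le_conjugate (hle n) y
    have h2 : 0 ≤ star y * ((2⁻¹ : ℝ) ^ n • e n) * y := star_left_conjugate_nonneg (hpos n) y
    rw [mul_assoc (star y) z y, hy, mul_zero] at h1
    have h3 := le_antisymm h1 h2
    rw [mul_smul_comm, smul_mul_assoc, smul_eq_zero_iff_right (by positivity)] at h3
    apply eq_zero_of_star_mul_self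
    rw [star_mul, (he n).1, mul_assoc, ← mul_assoc (e n), (he n).2, ← mul_assoc, h3]
  refine ⟨s, hs.1, fun n => ?_, fun y hy => hs.2.2 _ ?_⟩
  · have h1 : e n * s = e n :=
      mul_eq_of_forall_mul_eq_zero (fun y hy => hann y n hy) hs.2.1
    simpa [hs.1.1, (he n).1] using congrArg star h1
  · rw [hz, ← hsum.tsum_mul_right]
    simp [smul_mul_assoc, hy]

/-- A continuous cutoff on the real line, vanishing for `|t| ≤ 1 / (n + 1)` and equal to one for
`|t| ≥ 1 / n`. -/
noncomputable def cutoff (n : ℕ) (t : ℝ) : ℝ := min 1 (max 0 (n * ((n + 1) * |t| - 1)))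

/-- A continuous function on the real line, equal to `t⁻¹` for `|t| ≥ 1 / (n + 2)`. -/
noncomputable def cutInv (n : ℕ) (t : ℝ) : ℝ := t / max (t ^ 2) ((1 / ((n : ℝ) + 2)) ^ 2)

theorem continuous_cutoff (n : ℕ) : Continuous (cutoff n) := by
  unfold cutoff; fun_prop

theorem continuous_cutInv (n : ℕ) : Continuous (cutInv n) := by
  unfold cutInv
  refine continuous_id.div (by fun_prop) fun t => ?_
  have : 0 < (1 / ((n : ℝ) + 2)) ^ 2 := by positivity
  exact (lt_max_of_lt_right this).ne'

theorem cutoff_apply_zero (n : ℕ) : cutoff n 0 = 0 := by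
  simp [cutoff]

theorem cutoff_zero_left (t : ℝ) : cutoff 0 t = 0 := by
  simp [cutoff]

theorem cutInv_apply_zero (n : ℕ) : cutInv n 0 = 0 := by
  simp [cutInv]

theorem cutoff_nonneg (n : ℕ) (t : ℝ) : 0 ≤ cutoff n t :=
  le_min zero_le_one (le_max_left _ _)

theorem cutoff_le_one (n : ℕ) (t : ℝ) : cutoff n t ≤ 1 := min_le_left _ _

theorem cutoff_eq_zero {n : ℕ} {t : ℝ} (h : ((n : ℝ) + 1) * |t| ≤ 1) : cutoff n t = 0 := by
  have h1 : (n : ℝ) * ((n + 1) * |t| - 1) ≤ 0 :=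
    mul_nonpos_of_nonneg_of_nonpos (by positivity) (by linarith)
  rw [cutoff, max_eq_left h1, min_eq_right zero_le_one]

theorem cutoff_eq_one {n : ℕ} {t : ℝ} (h : 1 ≤ (n : ℝ) * |t|) : cutoff n t = 1 := by
  have h2 : 0 ≤ (n : ℝ) := by positivity
  have h1 : (1 : ℝ) ≤ (n : ℝ) * ((n + 1) * |t| - 1) := by nlinarith
  rw [cutoff, min_eq_left]
  exact h1.trans (le_max_right _ _)

theorem cutoff_mul_cutoff_succ (n : ℕ) (t : ℝ) : cutoff n t * cutoff (n + 1) t = cutoff n t := by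
  rcases le_total (((n : ℝ) + 1) * |t|) 1 with h | h
  · rw [cutoff_eq_zero h, zero_mul]
  · rw [cutoff_eq_one (n := n + 1) (by push_cast; exact h), mul_one]

theorem cutoff_succ_mul_mul_cutInv (n : ℕ) (t : ℝ) :
    cutoff (n + 1) t * (t * cutInv n t) = cutoff (n + 1) t := by
  rcases le_total (((n : ℝ) + 2) * |t|) 1 with h | h
  · rw [cutoff_eq_zero (n := n + 1) (by push_cast; linarith), zero_mul]
  · have h1 : 1 / ((n : ℝ) + 2) ≤ |t| := by
      rw [div_le_iff₀ (by positivity)]; linarith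
    have h2 : (1 / ((n : ℝ) + 2)) ^ 2 ≤ t ^ 2 := by
      rw [← sq_abs t]; gcongr
    have h3 : 0 < |t| := lt_of_lt_of_le (by positivity) h1
    have h4 : t ≠ 0 := abs_pos.1 h3
    rw [cutInv, max_eq_left h2]
    field_simp

theorem abs_sub_mul_cutoff_le (n : ℕ) (t : ℝ) : |t - t * cutoff (n + 1) t| ≤ 1 / ((n : ℝ) + 1) := by
  rcases le_total 1 (((n : ℝ) + 1) * |t|) with h | h
  · rw [cutoff_eq_one (n := n + 1) (by push_cast; exact h), mul_one, sub_self, abs_zero]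
    positivity
  · have h1 : |t| ≤ 1 / ((n : ℝ) + 1) := by
      rw [le_div_iff₀ (by positivity)]; linarith
    rw [← mul_one_sub, abs_mul, abs_of_nonneg (sub_nonneg.2 (cutoff_le_one _ _))]
    have := cutoff_nonneg (n + 1) t
    have := abs_nonneg t
    nlinarith

/-- Orthogonal projections `c n` commuting with `h`, whose sum is the support of `h`, together with
inverses `k n` of `h` on the range of `c n`. -/
structure IsSpectralPartition (h : A) (c k : ℕ → A) : Prop where
  isProjection : ∀ n, IsProjection (c n)
  orthogonal : ∀ m n, m ≠ n → c m * c n = 0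
  star_k : ∀ n, star (k n) = k n
  k_mul : ∀ n, k n * h = c n
  mul_k : ∀ n, h * k n = c n
  k_mul_c : ∀ n, k n * c n = k n
  c_mul_k : ∀ n, c n * k n = k n
  mul_eq_zero : ∀ z, (∀ n, c n * z = 0) → h * z = 0

theorem exists_isSpectralPartition (hA : WeaklyRickart A) {h : A} (hh : IsSelfAdjoint h) :
    ∃ c k, IsSpectralPartition h c k := by
  set F : ℕ → A := fun n => cfcₙ (cutoff n) h with hF
  set G : ℕ → A := fun n => cfcₙ (cutInv n) h with hG
  have hFs : ∀ n, IsSelfAdjoint (F n) := fun n => cfcₙ_predicate _ _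
  have hGs : ∀ n, IsSelfAdjoint (G n) := fun n => cfcₙ_predicate _ _
  have hid : cfcₙ (fun t : ℝ => t) h = h := cfcₙ_id' ℝ h
  have cF := fun n => (continuous_cutoff n).continuousOn (s := quasispectrum ℝ h)
  have cG := fun n => (continuous_cutInv n).continuousOn (s := quasispectrum ℝ h)
  have cI : ContinuousOn (fun t : ℝ => t) (quasispectrum ℝ h) := continuousOn_id
  have cIF : ∀ n, ContinuousOn (fun t : ℝ => t * cutoff n t) (quasispectrum ℝ h) :=
    fun n => cI.mul (cF n)
  have cIG : ∀ n, ContinuousOn (fun t : ℝ => t * cutInv n t) (quasispectrum ℝ h) :=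
    fun n => cI.mul (cG n)
  have hFF : ∀ n, F n * F (n + 1) = F n := fun n => by
    rw [hF]
    simp only
    rw [← cfcₙ_mul _ _ h (cF n) (cutoff_apply_zero n) (cF _) (cutoff_apply_zero _)]
    exact cfcₙ_congr fun t _ => cutoff_mul_cutoff_succ n t
  have hFh : ∀ n, F n * h = h * F n := fun n => by
    have := cfcₙ_commute_cfcₙ (cutoff n) (fun t : ℝ => t) h
    rw [hid] at this
    exact this
  have hGh : ∀ n, G n * h = h * G n := fun n => by
    have := cfcₙ_commute_cfcₙ (cutInv n) (fun t : ℝ => t) h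
    rw [hid] at this
    exact this
  have hFG : ∀ m n, F m * G n = G n * F m := fun m n =>
    cfcₙ_commute_cfcₙ (cutoff m) (cutInv n) h
  have hhG : ∀ n, h * G n = cfcₙ (fun t => t * cutInv n t) h := fun n => by
    rw [cfcₙ_mul _ _ h cI rfl (cG n) (cutInv_apply_zero n), hid]
  have hFhG : ∀ n, F (n + 1) * (h * G n) = F (n + 1) := fun n => by
    rw [hhG, hF]
    simp only
    rw [← cfcₙ_mul _ _ h (cF _) (cutoff_apply_zero _) (cIG n) (by simp)]
    exact cfcₙ_congr fun t _ => cutoff_succ_mul_mul_cutInv n t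
  have hnorm : ∀ n : ℕ, ‖h - h * F (n + 1)‖ ≤ 1 / ((n : ℝ) + 1) := fun n => by
    have h1 : h - h * F (n + 1) = cfcₙ (fun t => t - t * cutoff (n + 1) t) h := by
      rw [cfcₙ_sub _ _ h cI rfl (cIF _) (by simp),
        cfcₙ_mul _ _ h cI rfl (cF _) (cutoff_apply_zero _), hid]
    rw [h1]
    exact norm_cfcₙ_le fun t _ => abs_sub_mul_cutoff_le n t
  choose E hE using fun n => hA (F n)
  have hE0 : E 0 = 0 := by
    have h0 : F 0 = 0 := by
      have : cutoff 0 = fun _ => 0 := funext cutoff_zero_left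
      simp only [hF, this]
      exact cfcₙ_const_zero ℝ h
    have := (hE 0).2.2 (E 0) (by rw [h0, zero_mul])
    rwa [(hE 0).1.2] at this
  have hEh : ∀ n, E n * h = h * E n := fun n => (hE n).commute hh (hFh n)
  have hEG : ∀ m n, E m * G n = G n * E m := fun m n => (hE m).commute (hGs n) (hFG m n)
  have hEE1 : ∀ n, E n * E (n + 1) = E n := fun n => by
    refine mul_eq_of_forall_mul_eq_zero (hE n).2.2 ?_
    calc F n * E (n + 1) = F n * (F (n + 1) * E (n + 1)) := by rw [← mul_assoc, hFF]
      _ = F n := by rw [(hE (n + 1)).2.1, hFF]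
  have hEE : ∀ m n, m ≤ n → E m * E n = E m := fun m n hmn => by
    induction n, hmn using Nat.le_induction with
    | base => exact (hE m).1.2
    | succ n _ ih => rw [← ih, mul_assoc, hEE1]
  have hEE' : ∀ m n, m ≤ n → E n * E m = E m := fun m n hmn => by
    rw [(hE m).1.star_mul_eq (hE n).1 (hEE m n hmn), (hE m).1.1]
  have hEhG : ∀ n, E (n + 1) * (h * G n) = E (n + 1) := fun n =>
    mul_eq_of_forall_mul_eq_zero (hE (n + 1)).2.2 (hFhG n)
  set c : ℕ → A := fun n => E (n + 1) - E n with hc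
  have hcp : ∀ n, IsProjection (c n) := fun n =>
    (hE _).1.sub (hE _).1 (hEE' _ _ n.le_succ)
  have hch : ∀ n, c n * h = h * c n := fun n => by simp only [hc, sub_mul, mul_sub, hEh]
  have hcG : ∀ n, c n * G n = G n * c n := fun n => by simp only [hc, sub_mul, mul_sub, hEG]
  have hcE : ∀ n, c n * E (n + 1) = c n := fun n => by
    simp only [hc, sub_mul, (hE (n + 1)).1.2, hEE1]
  have hchG : ∀ n, c n * (h * G n) = c n := fun n => by
    rw [← hcE, mul_assoc, hEhG]
  have hort : ∀ m n, m < n → c m * c n = 0 := fun m n hmn => by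
    simp only [hc, sub_mul, mul_sub]
    rw [hEE _ _ (by omega), hEE _ _ (by omega), hEE _ _ (by omega), hEE _ _ (by omega)]
    simp
  refine ⟨c, fun n => G n * c n, hcp, fun m n hmn => ?_, fun n => ?_, fun n => ?_, fun n => ?_,
    fun n => ?_, fun n => ?_, fun z hz => ?_⟩
  · rcases lt_or_gt_of_ne hmn with h1 | h1
    · exact hort m n h1
    · rw [(hcp n).star_mul_eq (hcp m) (hort n m h1), star_zero]
  · rw [star_mul, (hcp n).1, (hGs n).star_eq, hcG]
  · rw [mul_assoc, hch, ← mul_assoc, hGh, mul_assoc, ← hcG, ← mul_assoc, ← hch, mul_assoc, hchG]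
  · rw [← hcG, ← mul_assoc, ← hch, mul_assoc, hchG]
  · rw [mul_assoc, (hcp n).2]
  · rw [← mul_assoc, hcG, mul_assoc, (hcp n).2]
  · have hEz : ∀ n, E n * z = 0 := fun n => by
      induction n with
      | zero => rw [hE0, zero_mul]
      | succ n ih =>
        have := hz n
        rwa [hc, sub_mul, ih, sub_zero] at this
    have hle : ∀ n : ℕ, ‖h * z‖ ≤ 1 / ((n : ℝ) + 1) * ‖z‖ := fun n => by
      have h1 : F (n + 1) * z = 0 := by
        rw [← (hE (n + 1)).2.1, mul_assoc, hEz, mul_zero]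
      have h2 : h * z = (h - h * F (n + 1)) * z := by
        rw [sub_mul, mul_assoc, h1, mul_zero, sub_zero]
      rw [h2]
      exact (norm_mul_le _ _).trans (by gcongr; exact hnorm n)
    have hlim := (tendsto_one_div_add_atTop_nhds_zero_nat (𝕜 := ℝ)).mul_const ‖z‖
    rw [zero_mul] at hlim
    exact norm_le_zero_iff.1 (ge_of_tendsto' hlim hle)

theorem mul_mul_of_mul_eq {a b c : A} (h : a * b = c) (z : A) : a * (b * z) = c * z := by
  rw [← mul_assoc, h]

theorem mul_mul_eq_zero {a b : A} (h : a * b = 0) (z : A) : a * (b * z) = 0 := by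
  rw [← mul_assoc, h, zero_mul]

/-- A sequence of partial isometries with mutually orthogonal initial projections and mutually
orthogonal final projections. -/
structure OrthFam (v : ℕ → A) : Prop where
  mul_star_mul : ∀ i, v i * (star (v i) * v i) = v i
  star_mul_eq_zero : ∀ i j, i ≠ j → star (v i) * v j = 0
  mul_star_eq_zero : ∀ i j, i ≠ j → v i * star (v j) = 0

/-- The partial isometries `v i` have a sum. -/
def Addable (v : ℕ → A) : Prop :=
  ∃ u : A, (∀ i, u * (star (v i) * v i) = v i) ∧ ∀ z, (∀ i, v i * z = 0) → u * z = 0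

theorem isProjection_star_mul_self {v : A} (h : v * (star v * v) = v) :
    IsProjection (star v * v) :=
  ⟨by rw [star_mul, star_star], by rw [mul_assoc, h]⟩

theorem star_mul_mul_star {v : A} (h : v * (star v * v) = v) : star v * (v * star v) = star v := by
  simpa [mul_assoc] using congrArg star h

theorem isProjection_mul_star_self {v : A} (h : v * (star v * v) = v) :
    IsProjection (v * star v) :=
  ⟨by rw [star_mul, star_star], by rw [mul_assoc, star_mul_mul_star h]⟩

theorem addable_of_mul_eq (hA : WeaklyRickart A) {v : ℕ → A} (hv : OrthFam v) {u : A}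
    (hu : ∀ i, u * (star (v i) * v i) = v i) : Addable v := by
  obtain ⟨s, hs⟩ := exists_isProjSup hA fun i => isProjection_star_mul_self (hv.mul_star_mul i)
  refine ⟨u * s, fun i => by rw [mul_assoc, hs.mul_eq, hu], fun z hz => ?_⟩
  rw [mul_assoc, hs.mul_eq_zero z fun i => by rw [mul_assoc, hz, mul_zero], mul_zero]

theorem OrthFam.addable_of_mul_eq_zero (hA : WeaklyRickart A) {v : ℕ → A} (hv : OrthFam v)
    (hvv : ∀ i j, v i * v j = 0) : Addable v := by
  have h1 := hv.mul_star_mul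
  have h1' : ∀ i, star (v i) * (v i * star (v i)) = star (v i) :=
    fun i => star_mul_mul_star (h1 i)
  have hvv' : ∀ i j, star (v i) * star (v j) = 0 := fun i j => by rw [← star_mul, hvv, star_zero]
  have e1 := fun i j => mul_mul_eq_zero (hvv i j)
  have e2 := fun i j => mul_mul_eq_zero (hvv' i j)
  set g : ℕ → A := fun i =>
    (2⁻¹ : ℝ) • (star (v i) * v i + v i * star (v i) + v i + star (v i)) with hg
  have hgp : ∀ i, IsProjection (g i) := fun i => by
    constructor
    · simp only [hg, star_smul, star_add, star_mul, star_star, star_trivial]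
      congr 1
      abel
    · simp only [hg, smul_mul_assoc, mul_smul_comm, mul_add, add_mul, mul_assoc, h1, h1', hvv, hvv',
        e1, e2, mul_zero]
      module
  have hgg : ∀ i j, i ≠ j → g i * g j = 0 := fun i j hij => by
    have a1 := hv.star_mul_eq_zero i j hij
    have a2 := hv.mul_star_eq_zero i j hij
    have b1 := mul_mul_eq_zero a1
    have b2 := mul_mul_eq_zero a2
    simp only [hg, smul_mul_assoc, mul_smul_comm, mul_add, add_mul, mul_assoc, hvv, hvv',
        e1, e2, mul_zero, a1, a2, b1, b2, add_zero, smul_zero]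
  have hgc : ∀ i, (2 : ℝ) • (g i * (star (v i) * v i)) = star (v i) * v i + v i := fun i => by
    simp only [hg, smul_mul_assoc, add_mul, mul_assoc, h1, e2, mul_zero]
    module
  have hcg : ∀ i j, i ≠ j → star (v i) * v i * g j = 0 := fun i j hij => by
    have a2 := hv.mul_star_eq_zero i j hij
    have b2 := mul_mul_eq_zero a2
    simp only [hg, mul_smul_comm, mul_add, mul_assoc, hvv, e1, mul_zero, a2, b2, add_zero,
      smul_zero]
  obtain ⟨s, hs⟩ := exists_isProjSup hA hgp
  obtain ⟨c, hc⟩ := exists_isProjSup hA fun i => isProjection_star_mul_self (h1 i)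
  have key : ∀ i, s * (star (v i) * v i) = g i * (star (v i) * v i) := fun i => by
    have h0 : (star (v i) * v i - star (v i) * v i * g i) * s = 0 := by
      refine hs.eq_zero_left hgp fun j => ?_
      rcases eq_or_ne i j with rfl | hij
      · rw [sub_mul, mul_assoc _ (g i), (hgp i).2, sub_self]
      · rw [sub_mul, hcg i j hij, mul_assoc _ (g i), hgg i j hij, mul_zero, sub_zero]
    rw [sub_mul, mul_assoc _ (g i), hs.mul_eq_right hgp, sub_eq_zero] at h0
    have h2 := congrArg star h0
    rwa [star_mul, star_mul _ (g i), (hgp i).1, hs.isProjection.1,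
      (isProjection_star_mul_self (h1 i)).1] at h2
  refine addable_of_mul_eq hA hv (u := (2 : ℝ) • s - c) fun i => ?_
  rw [sub_mul, smul_mul_assoc, key, hgc, hc.mul_eq, add_sub_cancel_left]

theorem IsSpectralPartition.star_mul_self_mul {h y : A} {c k : ℕ → A}
    (hs : IsSpectralPartition h c k) (hy : star y * y = h * h) (i j : ℕ) :
    star (y * k i) * (y * k j) = c i * c j := by
  calc star (y * k i) * (y * k j) = k i * (star y * y) * k j := by
        rw [star_mul, hs.star_k]; simp only [mul_assoc]
    _ = (k i * h) * (h * k j) := by rw [hy]; simp only [mul_assoc]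
    _ = c i * c j := by rw [hs.k_mul, hs.mul_k]

theorem IsSpectralPartition.orthFam {h y : A} {c k : ℕ → A} (hs : IsSpectralPartition h c k)
    (hy : star y * y = h * h) : OrthFam fun n => y * k n where
  mul_star_mul i := by
    rw [hs.star_mul_self_mul hy, (hs.isProjection i).2, mul_assoc, hs.k_mul_c]
  star_mul_eq_zero i j hij := by rw [hs.star_mul_self_mul hy, hs.orthogonal i j hij]
  mul_star_eq_zero i j hij := by
    rw [star_mul, hs.star_k, ← hs.k_mul_c i, ← hs.c_mul_k j]
    simp only [mul_assoc]
    rw [mul_mul_eq_zero (hs.orthogonal i j hij), mul_zero, mul_zero]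

/-- `u` is the partial isometry in a polar decomposition `y = u * h`. -/
structure IsPolar (y h p u : A) : Prop where
  mul_eq : u * h = y
  mul_eq_zero : ∀ z, h * z = 0 → u * z = 0
  star_mul_self : star u * u = p
  mul_supp : u * p = u

theorem IsSpectralPartition.exists_isPolar {h y p : A} {c k : ℕ → A}
    (hs : IsSpectralPartition h c k) (hh : IsSelfAdjoint h) (hy : star y * y = h * h)
    (hadd : Addable fun n => y * k n) (hp : IsARP h p) : ∃ u, IsPolar y h p u := by
  obtain ⟨u, hu, hu0⟩ := hadd
  have huc : ∀ n, u * c n = y * k n := fun n => by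
    have := hu n
    rwa [hs.star_mul_self_mul hy, (hs.isProjection n).2] at this
  have hhh : star h * h = star y * y := by rw [hy, hh.star_eq]
  have hcomm : ∀ n, h * c n = c n * h := fun n => by
    rw [← hs.mul_k n, mul_assoc h (k n), hs.k_mul, hs.mul_k]
  have huh : u * h = y := by
    have h1 : ∀ n, (u * h - y) * c n = 0 := fun n => by
      rw [sub_mul, mul_assoc, hcomm, ← mul_assoc, huc, mul_assoc, hs.k_mul, sub_self]
    have h2 : ∀ n, c n * star (u * h - y) = 0 := fun n => by
      have := congrArg star (h1 n)
      rwa [star_mul, star_zero, (hs.isProjection n).1] at this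
    have h3 := hs.mul_eq_zero _ h2
    have h4 := mul_eq_zero_of_star_mul_self_eq hhh.symm h3
    have h3' := congrArg star h3
    have h4' := congrArg star h4
    rw [star_mul, star_star, star_zero] at h3' h4'
    rw [hh.star_eq] at h3'
    refine sub_eq_zero.1 ((CStarRing.mul_star_self_eq_zero_iff _).1 ?_)
    rw [star_sub, star_mul, hh.star_eq, mul_sub, ← mul_assoc, h3', h4', zero_mul, sub_zero]
  have hz : ∀ z, h * z = 0 → u * z = 0 := fun z hz => hu0 z fun n => by
    rw [mul_assoc, ← hs.k_mul_c, ← hs.k_mul]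
    simp only [mul_assoc]
    rw [hz, mul_zero, mul_zero, mul_zero]
  have hup : u * p = u := mul_eq_of_forall_mul_eq_zero hz hp.2.1
  refine ⟨u, huh, hz, ?_, hup⟩
  have hpu : p * star u = star u := by
    rw [← hp.1.1, ← star_mul, hup]
  have ht : p * (star u * u - p) = star u * u - p := by
    rw [mul_sub, ← mul_assoc, hpu, hp.1.2]
  have ht' : (star u * u - p) * p = star u * u - p := by
    rw [sub_mul, mul_assoc, hup, hp.1.2]
  have h1 : h * ((star u * u - p) * h) = 0 := by
    have : h * ((star u * u - p) * h) = star (u * h) * (u * h) - h * (p * h) := by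
      rw [star_mul, hh.star_eq]
      simp only [mul_sub, sub_mul, mul_assoc]
    rw [this, huh, hy, hp.mul_left_eq hh, sub_self]
  have h2 := hp.2.2 _ h1
  rw [← mul_assoc, ht] at h2
  have h3 := hp.mul_eq_zero_left hh h2
  rw [ht'] at h3
  exact sub_eq_zero.1 h3

theorem exists_isPolar_of_mul_self_eq_zero (hA : WeaklyRickart A) {h y p : A}
    (hh : IsSelfAdjoint h) (hy : star y * y = h * h) (hyy : y * y = 0) (hp : IsARP h p) :
    ∃ u, IsPolar y h p u := by
  obtain ⟨c, k, hs⟩ := exists_isSpectralPartition hA hh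
  refine hs.exists_isPolar hh hy ((hs.orthFam hy).addable_of_mul_eq_zero hA fun i j => ?_) hp
  have h1 : h * y = 0 := mul_eq_zero_of_star_mul_self_eq (by rw [hh.star_eq, hy]) hyy
  rw [mul_assoc, ← hs.k_mul_c i, ← hs.k_mul i]
  simp only [mul_assoc]
  rw [mul_mul_eq_zero h1]
  simp only [mul_zero]

/-- For a self-adjoint contraction `a`, the difference between `2 • a` and the sign of `a` is again
a contraction. -/
theorem exists_sign (hA : WeaklyRickart A) {a : A} (ha : IsSelfAdjoint a) (ha1 : ‖a‖ ≤ 1) :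
    ∃ P N : A, IsProjection P ∧ IsProjection N ∧ ‖(2 : ℝ) • a - (P - N)‖ ≤ 1 ∧
      ∀ z, a * z = 0 → P * z = 0 ∧ N * z = 0 := by
  let _ := CStarAlgebra.spectralOrder A
  let _ := CStarAlgebra.spectralOrderedRing A
  set p : A := cfcₙ (fun t : ℝ => max t 0) a with hp
  set m : A := cfcₙ (fun t : ℝ => max (-t) 0) a with hm
  have hps : IsSelfAdjoint p := cfcₙ_predicate _ _
  have hms : IsSelfAdjoint m := cfcₙ_predicate _ _
  have cp : ContinuousOn (fun t : ℝ => max t 0) (quasispectrum ℝ a) := by fun_prop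
  have cm : ContinuousOn (fun t : ℝ => max (-t) 0) (quasispectrum ℝ a) := by fun_prop
  have hsub : p - m = a := by
    rw [hp, hm, ← cfcₙ_sub _ _ a cp (by simp) cm (by simp)]
    conv_rhs => rw [← cfcₙ_id' ℝ a]
    refine cfcₙ_congr fun t _ => ?_
    rcases le_total 0 t with h | h
    · rw [max_eq_left h, max_eq_right (neg_nonpos.2 h), sub_zero]
    · rw [max_eq_right h, max_eq_left (neg_nonneg.2 h)]; ring
  have hpm : p * m = 0 := by
    rw [hp, hm, ← cfcₙ_mul _ _ a cp (by simp) cm (by simp), ← cfcₙ_const_zero ℝ a]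
    refine cfcₙ_congr fun t _ => ?_
    rcases le_total 0 t with h | h
    · rw [max_eq_right (neg_nonpos.2 h), mul_zero]
    · rw [max_eq_right h, zero_mul]
  have hmp : m * p = 0 := by
    simpa [hps.star_eq, hms.star_eq] using congrArg star hpm
  have hpos : 0 ≤ p + m - a * a := by
    have h1 : p + m - a * a = cfcₙ (fun t : ℝ => |t| - t * t) a := by
      rw [cfcₙ_sub _ _ a (by fun_prop) (by simp) (by fun_prop) (by simp),
        cfcₙ_mul _ _ a (by fun_prop) rfl (by fun_prop) rfl, cfcₙ_id' ℝ a, hp, hm,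
        ← cfcₙ_add _ _ a cp (by simp) cm (by simp)]
      congr 1
      refine cfcₙ_congr fun t _ => ?_
      rcases le_total 0 t with h | h
      · rw [max_eq_left h, max_eq_right (neg_nonpos.2 h), add_zero, abs_of_nonneg h]
      · rw [max_eq_right h, max_eq_left (neg_nonneg.2 h), zero_add, abs_of_nonpos h]
    rw [h1]
    refine cfcₙ_nonneg fun t ht => ?_
    have h2 : |t| ≤ 1 := by
      have := norm_apply_le_norm_cfcₙ (fun t : ℝ => t) a ht (by fun_prop) rfl ha
      rw [cfcₙ_id' ℝ a] at this
      exact this.trans ha1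
    have h3 : |t| * |t| = t * t := abs_mul_abs_self t
    have h4 := abs_nonneg t
    nlinarith
  obtain ⟨P, hP⟩ := hA p
  obtain ⟨N, hN⟩ := hA m
  have hpN : p * N = 0 := hN.mul_eq_zero_left hms hpm
  have hmP : m * P = 0 := hP.mul_eq_zero_left hps hmp
  have hPN : P * N = 0 := hP.2.2 _ hpN
  have hNP : N * P = 0 := hN.2.2 _ hmP
  have haP : a * P = p := by rw [← hsub, sub_mul, hP.2.1, hmP, sub_zero]
  have haN : a * N = -m := by rw [← hsub, sub_mul, hN.2.1, hpN, zero_sub]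
  have hPa : P * a = p := by simpa [ha.star_eq, hP.1.1, hps.star_eq] using congrArg star haP
  have hNa : N * a = -m := by simpa [ha.star_eq, hN.1.1, hms.star_eq] using congrArg star haN
  refine ⟨P, N, hP.1, hN.1, ?_, fun z hz => ⟨hP.2.2 z ?_, hN.2.2 z ?_⟩⟩
  · set b := (2 : ℝ) • a - (P - N) with hb
    have hbs : star b = b := by
      rw [hb, star_sub, star_sub, star_smul, star_trivial, ha.star_eq, hP.1.1, hN.1.1]
    have hQ : IsProjection (P + N) := by
      refine ⟨by rw [star_add, hP.1.1, hN.1.1], ?_⟩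
      rw [mul_add, add_mul, add_mul, hP.1.2, hN.1.2, hPN, hNP, add_zero, zero_add]
    have h1 : P + N - star b * b = (4 : ℝ) • (p + m - a * a) := by
      rw [hbs, hb]
      simp only [mul_sub, sub_mul, smul_mul_assoc, mul_smul_comm, haP, haN, hPa, hNa, hPN, hNP,
        hP.1.2, hN.1.2]
      module
    have h2 : star b * b ≤ P + N := by
      rw [← sub_nonneg, h1]
      exact smul_nonneg (by norm_num) hpos
    have h3 := CStarAlgebra.norm_le_norm_of_nonneg_of_le (star_mul_self_nonneg b) h2
    rw [CStarRing.norm_star_mul_self] at h3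
    have h4 := hQ.norm_le_one
    nlinarith [norm_nonneg b]
  · rw [← hPa, mul_assoc, hz, mul_zero]
  · rw [← neg_neg m, ← hNa, neg_mul, mul_assoc, hz, mul_zero, neg_zero]

/-- A sequence of mutually orthogonal self-adjoint contractions. -/
structure IsOrthSeq (a : ℕ → A) : Prop where
  isSelfAdjoint : ∀ i, IsSelfAdjoint (a i)
  norm_le : ∀ i, ‖a i‖ ≤ 1
  orthogonal : ∀ i j, i ≠ j → a i * a j = 0

theorem IsProjSup.mul_eq_of_orthogonal {e : ℕ → A} {s : A} (hs : IsProjSup e s)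
    (he : ∀ i, IsProjection (e i)) (horth : ∀ i j, i ≠ j → e i * e j = 0) {j : ℕ} {z : A}
    (hz : ∀ i, i ≠ j → e i * z = 0) : s * z = e j * z := by
  have h : s * (z - e j * z) = 0 := hs.mul_eq_zero _ fun i => by
    rcases eq_or_ne i j with rfl | hij
    · rw [mul_sub, ← mul_assoc, (he i).2, sub_self]
    · rw [mul_sub, ← mul_assoc, horth i j hij, hz i hij, zero_mul, sub_zero]
  rwa [mul_sub, ← mul_assoc, hs.mul_eq, sub_eq_zero] at h

theorem IsOrthSeq.exists_next (hA : WeaklyRickart A) {a : ℕ → A} (ha : IsOrthSeq a) :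
    ∃ (S : A) (a' : ℕ → A), IsOrthSeq a' ∧ ‖S‖ ≤ 2 ∧ (∀ i z, a i * z = 0 → a' i * z = 0) ∧
      ∀ j z, (∀ i, i ≠ j → a i * z = 0) → (2 : ℝ) • (a j * z) = S * z + a' j * z := by
  choose P N hP hN hnorm hann using fun i => exists_sign hA (ha.isSelfAdjoint i) (ha.norm_le i)
  obtain ⟨s, hs⟩ := exists_isProjSup hA hP
  obtain ⟨t, ht⟩ := exists_isProjSup hA hN
  have hstar : ∀ {x y : A}, IsSelfAdjoint x → IsSelfAdjoint y → x * y = 0 → y * x = 0 :=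
    fun hx hy h => by simpa [hx.star_eq, hy.star_eq] using congrArg star h
  have haP : ∀ i j, i ≠ j → a i * P j = 0 := fun i j hij =>
    hstar (hP j).1 (ha.isSelfAdjoint i) (hann j _ (ha.orthogonal j i hij.symm)).1
  have haN : ∀ i j, i ≠ j → a i * N j = 0 := fun i j hij =>
    hstar (hN j).1 (ha.isSelfAdjoint i) (hann j _ (ha.orthogonal j i hij.symm)).2
  have hann' : ∀ i z, a i * z = 0 → ((2 : ℝ) • a i - (P i - N i)) * z = 0 := fun i z hz => by
    rw [sub_mul, sub_mul, smul_mul_assoc, hz, (hann i z hz).1, (hann i z hz).2]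
    simp
  refine ⟨s - t, fun i => (2 : ℝ) • a i - (P i - N i), ⟨fun i => ?_, hnorm, fun i j hij => ?_⟩,
    ?_, hann', fun j z hz => ?_⟩
  · rw [isSelfAdjoint_iff, star_sub, star_sub, star_smul, star_trivial,
      (ha.isSelfAdjoint i).star_eq, (hP i).1, (hN i).1]
  · rw [mul_sub, mul_sub, mul_smul_comm, hann' i _ (ha.orthogonal i j hij),
      hann' i _ (haP i j hij), hann' i _ (haN i j hij)]
    simp
  · have h1 := hs.isProjection.norm_le_one
    have h2 := ht.isProjection.norm_le_one
    have h3 := norm_sub_le s t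
    linarith
  · have h1 := hs.mul_eq_of_orthogonal hP (fun i j hij => (hann i _ (haP i j hij)).1)
      (fun i hij => (hann i z (hz i hij)).1)
    have h2 := ht.mul_eq_of_orthogonal hN (fun i j hij => (hann i _ (haN i j hij)).2)
      (fun i hij => (hann i z (hz i hij)).2)
    rw [sub_mul, h1, h2, sub_mul, sub_mul, smul_mul_assoc]
    abel

theorem IsOrthSeq.exists_sum (hA : WeaklyRickart A) {a : ℕ → A} (ha : IsOrthSeq a) :
    ∃ E : A, ∀ j z, (∀ i, i ≠ j → a i * z = 0) → E * z = a j * z := by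
  choose S next hnext hS hann hstep using
    fun b : {b : ℕ → A // IsOrthSeq b} => b.2.exists_next hA
  set f : ℕ → {b : ℕ → A // IsOrthSeq b} := fun n =>
    Nat.rec ⟨a, ha⟩ (fun _ b => ⟨next b, hnext b⟩) n with hf
  have hf0 : (f 0).1 = a := rfl
  have hfs : ∀ n, (f (n + 1)).1 = next (f n) := fun n => rfl
  have hsum := summable_geometric_smul (e := fun n => (2⁻¹ : ℝ) • S (f n)) fun n => by
    rw [norm_smul, Real.norm_of_nonneg (by norm_num)]
    linarith [hS (f n)]
  refine ⟨∑' n, (2⁻¹ : ℝ) ^ n • ((2⁻¹ : ℝ) • S (f n)), fun j z hz => ?_⟩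
  have hfz : ∀ n i, i ≠ j → (f n).1 i * z = 0 := fun n => by
    induction n with
    | zero => exact hz
    | succ n ih => exact fun i hij => hann (f n) i z (ih i hij)
  have hpart : ∀ n, (∑ k ∈ Finset.range n, (2⁻¹ : ℝ) ^ k • ((2⁻¹ : ℝ) • S (f k))) * z =
      a j * z - (2⁻¹ : ℝ) ^ n • ((f n).1 j * z) := fun n => by
    induction n with
    | zero => simp [hf0]
    | succ n ih =>
      have h1 := hstep (f n) j z (hfz n)
      rw [← hfs] at h1
      have h2 : S (f n) * z = (2 : ℝ) • ((f n).1 j * z) - (f (n + 1)).1 j * z := by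
        rw [h1, add_sub_cancel_right]
      rw [Finset.sum_range_succ, add_mul, ih, smul_mul_assoc, smul_mul_assoc, h2, pow_succ]
      module
  have hlim1 := (hsum.hasSum.tendsto_sum_nat.mul_const z)
  have hlim2 : Filter.Tendsto (fun n => a j * z - (2⁻¹ : ℝ) ^ n • ((f n).1 j * z)) Filter.atTop
      (nhds (a j * z - 0)) := by
    refine tendsto_const_nhds.sub (squeeze_zero_norm (a := fun n => (2⁻¹ : ℝ) ^ n * ‖z‖) ?_ ?_)
    · intro n
      rw [norm_smul, norm_pow, Real.norm_of_nonneg (by norm_num : (0 : ℝ) ≤ 2⁻¹)]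
      gcongr
      exact (norm_mul_le _ _).trans
        (mul_le_of_le_one_left (norm_nonneg z) ((f n).2.norm_le j))
    · have := (tendsto_pow_atTop_nhds_zero_of_lt_one (r := (2⁻¹ : ℝ)) (by norm_num)
        (by norm_num)).mul_const ‖z‖
      rwa [zero_mul] at this
  rw [sub_zero] at hlim2
  simp only [hpart] at hlim1
  exact tendsto_nhds_unique hlim1 hlim2

theorem norm_le_one_of_mul_star_mul {v : A} (h : v * (star v * v) = v) : ‖v‖ ≤ 1 := by
  have h1 := (isProjection_star_mul_self h).norm_le_one
  rw [CStarRing.norm_star_mul_self] at h1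
  nlinarith [norm_nonneg v]

open scoped ComplexStarModule in
theorem OrthFam.addable_of_pairwise_mul_eq_zero (hA : WeaklyRickart A) {v : ℕ → A}
    (hv : OrthFam v) (hvv : ∀ i j, i ≠ j → v i * v j = 0) : Addable v := by
  have h1 := fun i => norm_le_one_of_mul_star_mul (hv.mul_star_mul i)
  have hvv' : ∀ i j, i ≠ j → star (v i) * star (v j) = 0 := fun i j hij => by
    rw [← star_mul, hvv j i hij.symm, star_zero]
  have ha : IsOrthSeq fun i => (ℜ (v i) : A) :=
    ⟨fun i => (ℜ (v i)).2, fun i => (realPart.norm_le (v i)).trans (h1 i), fun i j hij => by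
      simp only [realPart_apply_coe, smul_mul_assoc, mul_smul_comm, add_mul, mul_add,
        hvv i j hij, hvv' i j hij, hv.star_mul_eq_zero i j hij, hv.mul_star_eq_zero i j hij,
        add_zero, smul_zero]⟩
  have hb : IsOrthSeq fun i => (ℑ (v i) : A) :=
    ⟨fun i => (ℑ (v i)).2, fun i => (imaginaryPart.norm_le (v i)).trans (h1 i), fun i j hij => by
      simp only [imaginaryPart_apply_coe, smul_mul_assoc, mul_smul_comm, sub_mul, mul_sub,
        hvv i j hij, hvv' i j hij, hv.star_mul_eq_zero i j hij, hv.mul_star_eq_zero i j hij,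
        sub_zero, smul_zero]⟩
  obtain ⟨E, hE⟩ := ha.exists_sum hA
  obtain ⟨F, hF⟩ := hb.exists_sum hA
  refine addable_of_mul_eq hA hv (u := E + Complex.I • F) fun j => ?_
  rw [add_mul, smul_mul_assoc, hE j, hF j, ← smul_mul_assoc, ← add_mul,
    realPart_add_I_smul_imaginaryPart, hv.mul_star_mul]
  · intro i hij
    simp only [imaginaryPart_apply_coe, smul_mul_assoc, sub_mul,
      mul_mul_eq_zero (hv.mul_star_eq_zero i j hij), mul_mul_eq_zero (hvv' i j hij), sub_zero,
      smul_zero]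
  · intro i hij
    simp only [realPart_apply_coe, smul_mul_assoc, add_mul,
      mul_mul_eq_zero (hv.mul_star_eq_zero i j hij), mul_mul_eq_zero (hvv' i j hij), add_zero,
      smul_zero]

theorem exists_mul_self_eq_star_mul_self (a : A) :
    ∃ h : A, IsSelfAdjoint h ∧ h * h = star a * a := by
  let _ := CStarAlgebra.spectralOrder A
  let _ := CStarAlgebra.spectralOrderedRing A
  exact ⟨CFC.abs a, IsSelfAdjoint.of_nonneg (CFC.abs_nonneg a), CFC.abs_mul_abs a⟩

/-- Orthogonal projections `p` and `p'` can be cut down by equivalent subprojections in such a way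
that the corner of `x` between the remainders vanishes. -/
theorem exists_match (hA : WeaklyRickart A) {p p' : A} (hp : IsProjection p)
    (hp' : IsProjection p') (hpp : p' * p = 0) (x : A) :
    ∃ W : A, p * W = W ∧ W * p' = W ∧ W * (star W * W) = W ∧
      (p - W * star W) * x * (p' - star W * W) = 0 := by
  obtain ⟨h, hh, hha⟩ := exists_mul_self_eq_star_mul_self (p * x * p')
  obtain ⟨r, hr⟩ := hA h
  have haa : p * x * p' * (p * x * p') = 0 := by
    simp only [mul_assoc]
    rw [mul_mul_eq_zero hpp, mul_zero, mul_zero]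
  obtain ⟨u, hu⟩ := exists_isPolar_of_mul_self_eq_zero hA hh hha.symm haa hr
  have hhs : star h * h = star (p * x * p') * (p * x * p') := by rw [hh.star_eq, hha]
  have hhp : h * p' = h :=
    mul_eq_of_forall_mul_eq_zero (fun z hz => mul_eq_zero_of_star_mul_self_eq hhs hz)
      (by rw [mul_assoc, hp'.2])
  have hup : u * p' = u := mul_eq_of_forall_mul_eq_zero hu.mul_eq_zero hhp
  have hpu : p * u = u := by
    have h1 : (p * u - u) * h = 0 := by
      rw [sub_mul, mul_assoc, hu.mul_eq, mul_assoc, ← mul_assoc p p, hp.2, sub_self]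
    have h2 := hr.mul_eq_zero_left hh h1
    rwa [sub_mul, mul_assoc, hu.mul_supp, sub_eq_zero] at h2
  have huu : u * (star u * u) = u := by rw [hu.star_mul_self, hu.mul_supp]
  have hup' : star u * p = star u := by simpa [hp.1] using congrArg star hpu
  have hpu' : p' * star u = star u := by simpa [hp'.1] using congrArg star hup
  refine ⟨u, hpu, hup, huu, ?_⟩
  have h1 : (p - u * star u) * x * p' = 0 := by
    have : u * star u * x * p' = u * star u * (p * x * p') := by
      rw [← mul_assoc, ← mul_assoc, mul_assoc u _ p, hup']
    rw [sub_mul, sub_mul, this, ← hu.mul_eq, ← mul_assoc, mul_assoc u, huu, sub_self]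
  have h2 : p' - star u * u = p' * (p' - star u * u) := by
    rw [mul_sub, hp'.2, ← mul_assoc, hpu']
  rw [h2, ← mul_assoc, h1, zero_mul]

theorem IsProjSup.mul_eq_self {e : ℕ → A} {s q : A} (hs : IsProjSup e s)
    (hq : ∀ n, e n * q = e n) : s * q = s := by
  have h1 : s * (star (s - s * q) - q * star (s - s * q)) = 0 := hs.mul_eq_zero _ fun n => by
    rw [mul_sub, ← mul_assoc, hq, sub_self]
  rw [mul_sub, ← mul_assoc, ← sub_mul] at h1
  exact (sub_eq_zero.1 ((CStarRing.mul_star_self_eq_zero_iff _).1 h1)).symm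

/-- Partial isometries `W k` whose initial and final projections lie below initial projections of
the family `v`, together with remainders `ρ i` of these initial projections, between which `v`
has no off-diagonal corners. -/
structure IsMatching (v : ℕ → A) (n m : ℕ → ℕ) (W ρ : ℕ → A) : Prop where
  orthFam : OrthFam W
  mul_eq_zero : ∀ i j, W i * W j = 0
  left_mul : ∀ k, star (v (n k)) * v (n k) * W k = W k
  mul_right : ∀ k, W k * (star (v (m k)) * v (m k)) = W k
  isProjection : ∀ i, IsProjection (ρ i)
  left_mul_rem : ∀ i, star (v i) * v i * ρ i = ρ i
  rem_mul : ∀ i k, ρ i * W k = 0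
  mul_rem : ∀ i k, W k * ρ i = 0
  corner : ∀ i j, i ≠ j → ρ i * v j * ρ j = 0
  eq_zero : ∀ i z, z * (star (v i) * v i) = z → z * ρ i = 0 → (∀ k, z * W k = 0) →
    (∀ k, z * star (W k) = 0) → z = 0

/-- The properties of one step of the matching process for orthogonal projections `R i`. -/
structure IsMatchStep (v R R' : ℕ → A) (n m : ℕ) (W : A) : Prop where
  isProjection : ∀ i, IsProjection (R' i)
  mul_eq : ∀ i, R' i * R i = R' i
  mul_star_mul : W * (star W * W) = W
  mul_self : W * W = 0
  left_mul : R n * W = W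
  mul_right : W * R m = W
  rem_mul : ∀ i, R' i * W = 0
  mul_rem : ∀ i, W * R' i = 0
  corner : n ≠ m → R' n * v m * R' m = 0
  eq_self : ∀ i z, z * R i = z → z * W = 0 → z * star W = 0 → z * R' i = z

theorem exists_isMatchStep (hA : WeaklyRickart A) (v : ℕ → A) {R : ℕ → A}
    (hR : ∀ i, IsProjection (R i)) (horth : ∀ i j, i ≠ j → R i * R j = 0) (n m : ℕ) :
    ∃ (R' : ℕ → A) (W : A), IsMatchStep v R R' n m W := by
  rcases eq_or_ne n m with rfl | hnm
  · exact ⟨R, 0, hR, fun i => (hR i).2, by simp, by simp, by simp, by simp, by simp, by simp,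
      fun h => absurd rfl h, fun i z hz _ _ => hz⟩
  obtain ⟨W, hnW, hWm, hW, hcorner⟩ :=
    exists_match hA (hR n) (hR m) (horth m n hnm.symm) (v m)
  have hiW : ∀ i, i ≠ n → R i * W = 0 := fun i hi => by
    rw [← hnW, ← mul_assoc, horth i n hi, zero_mul]
  have hWi : ∀ i, i ≠ m → W * R i = 0 := fun i hi => by
    rw [← hWm, mul_assoc, horth m i hi.symm, mul_zero]
  have hWW : W * W = 0 := by
    nth_rewrite 1 [← hWm]
    rw [mul_assoc, hiW m hnm.symm, mul_zero]
  have hmW : R m * (star W * W) = star W * W := by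
    have h1 : R m * star W = star W := by simpa [(hR m).1] using congrArg star hWm
    rw [← mul_assoc, h1]
  have hnW' : R n * (W * star W) = W * star W := by rw [← mul_assoc, hnW]
  have hRn := (hR n).sub (isProjection_mul_star_self hW) hnW'
  have hRm := (hR m).sub (isProjection_star_mul_self hW) hmW
  set R' : ℕ → A := fun i =>
    if i = n then R n - W * star W else if i = m then R m - star W * W else R i with hR'
  have hR'n : R' n = R n - W * star W := if_pos rfl
  have hR'm : R' m = R m - star W * W := (if_neg hnm.symm).trans (if_pos rfl)
  have hR'i : ∀ i, i ≠ n → i ≠ m → R' i = R i := fun i h1 h2 =>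
    (if_neg h1).trans (if_neg h2)
  have hcases : ∀ P : ℕ → Prop, P n → P m → (∀ i, i ≠ n → i ≠ m → P i) → ∀ i, P i :=
    fun P h1 h2 h3 i => by
      rcases eq_or_ne i n with rfl | hin
      · exact h1
      · rcases eq_or_ne i m with rfl | him
        · exact h2
        · exact h3 i hin him
  have hsW : star W * (W * star W) = star W := star_mul_mul_star hW
  refine ⟨R', W, hcases _ ?_ ?_ ?_, hcases _ ?_ ?_ ?_, hW, hWW, hnW, hWm, hcases _ ?_ ?_ ?_,
    hcases _ ?_ ?_ ?_, fun _ => by rw [hR'n, hR'm, hcorner], fun i z hz h1 h2 => ?_⟩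
  · rw [hR'n]; exact hRn
  · rw [hR'm]; exact hRm
  · intro i h1 h2; rw [hR'i i h1 h2]; exact hR i
  · rw [hR'n, sub_mul, (hR n).2, (hR n).star_mul_eq (isProjection_mul_star_self hW) hnW',
      (isProjection_mul_star_self hW).1]
  · rw [hR'm, sub_mul, (hR m).2, mul_assoc, hWm]
  · intro i h1 h2; rw [hR'i i h1 h2]; exact (hR i).2
  · rw [hR'n, sub_mul, hnW, mul_assoc, hW, sub_self]
  · rw [hR'm, sub_mul, hiW m hnm.symm, mul_assoc, hWW, mul_zero, sub_zero]
  · intro i h1 h2; rw [hR'i i h1 h2]; exact hiW i h1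
  · rw [hR'n, mul_sub, hWi n hnm, mul_mul_eq_zero hWW, sub_zero]
  · rw [hR'm, mul_sub, hWm, hW, sub_self]
  · intro i h1 h2; rw [hR'i i h1 h2]; exact hWi i h2
  · revert hz
    refine hcases (fun i => z * R i = z → z * R' i = z) ?_ ?_ ?_ i
    · intro hz; rw [hR'n, mul_sub, hz, mul_mul_eq_zero h1, sub_zero]
    · intro hz; rw [hR'm, mul_sub, hz, mul_mul_eq_zero h2, sub_zero]
    · intro i hi1 hi2 hz; rw [hR'i i hi1 hi2, hz]

theorem IsMatchStep.orthogonal {v R R' : ℕ → A} {n m : ℕ} {W : A}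
    (h : IsMatchStep v R R' n m W) (hR : ∀ i, IsProjection (R i))
    (horth : ∀ i j, i ≠ j → R i * R j = 0) (i j : ℕ) (hij : i ≠ j) : R' i * R' j = 0 := by
  have h1 : R j * R' j = R' j := by
    rw [(h.isProjection j).star_mul_eq (hR j) (h.mul_eq j), (h.isProjection j).1]
  rw [← h.mul_eq i, ← h1, mul_assoc, mul_mul_eq_zero (horth i j hij), mul_zero]

theorem OrthFam.isProjection {v : ℕ → A} (hv : OrthFam v) (i : ℕ) :
    IsProjection (star (v i) * v i) :=
  isProjection_star_mul_self (hv.mul_star_mul i)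

theorem OrthFam.orthogonal {v : ℕ → A} (hv : OrthFam v) (i j : ℕ) (hij : i ≠ j) :
    star (v i) * v i * (star (v j) * v j) = 0 := by
  rw [mul_assoc, mul_mul_eq_zero (hv.mul_star_eq_zero i j hij), mul_zero]

theorem OrthFam.exists_isMatching (hA : WeaklyRickart A) {v : ℕ → A} (hv : OrthFam v) :
    ∃ (n m : ℕ → ℕ) (W ρ : ℕ → A), IsMatching v n m W ρ := by
  let State := {R : ℕ → A // (∀ i, IsProjection (R i)) ∧ ∀ i j, i ≠ j → R i * R j = 0}
  choose next V hnext using fun (k : ℕ) (R : State) =>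
    exists_isMatchStep hA v R.2.1 R.2.2 (Nat.unpair k).1 (Nat.unpair k).2
  let f : ℕ → State := fun k => Nat.rec ⟨fun i => star (v i) * v i, hv.isProjection, hv.orthogonal⟩
    (fun k R => ⟨next k R, (hnext k R).isProjection, (hnext k R).orthogonal R.2.1 R.2.2⟩) k
  obtain ⟨R, hR0, W, hstep, hRp⟩ : ∃ R : ℕ → ℕ → A, (R 0 = fun i => star (v i) * v i) ∧
      ∃ W : ℕ → A, (∀ k, IsMatchStep v (R k) (R (k + 1)) (Nat.unpair k).1 (Nat.unpair k).2 (W k)) ∧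
        ∀ k i, IsProjection (R k i) :=
    ⟨fun k => (f k).1, rfl, fun k => V k (f k), fun k => hnext k (f k), fun k => (f k).2.1⟩
  have hRR : ∀ i k l, k ≤ l → R l i * R k i = R l i := fun i k l hkl => by
    induction l, hkl using Nat.le_induction with
    | base => exact (hRp k i).2
    | succ l _ ih => rw [← (hstep l).mul_eq i, mul_assoc, ih]
  have hRR' : ∀ i k l, k ≤ l → R k i * R l i = R l i := fun i k l hkl => by
    rw [(hRp l i).star_mul_eq (hRp k i) (hRR i k l hkl), (hRp l i).1]
  have hc : ∀ i, R 0 i = star (v i) * v i := fun i => congrFun hR0 i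
  have hRW : ∀ i k l, k < l → R l i * W k = 0 := fun i k l hkl => by
    rw [← hRR i (k + 1) l hkl, mul_assoc, (hstep k).rem_mul, mul_zero]
  have hWR : ∀ i k l, k < l → W k * R l i = 0 := fun i k l hkl => by
    rw [← hRR' i (k + 1) l hkl, ← mul_assoc, (hstep k).mul_rem, zero_mul]
  have hRW' : ∀ i k l, k < l → R l i * star (W k) = 0 := fun i k l hkl => by
    simpa [(hRp l i).1] using congrArg star (hWR i k l hkl)
  have hWR' : ∀ i k l, k < l → star (W k) * R l i = 0 := fun i k l hkl => by
    simpa [(hRp l i).1] using congrArg star (hRW i k l hkl)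
  have hWW : ∀ k l, k < l → W l * W k = 0 ∧ W k * W l = 0 ∧ star (W k) * W l = 0 ∧
      W l * star (W k) = 0 := fun k l hkl => by
    refine ⟨?_, ?_, ?_, ?_⟩
    · rw [← (hstep l).mul_right, mul_assoc, hRW _ k l hkl, mul_zero]
    · rw [← (hstep l).left_mul, ← mul_assoc, hWR _ k l hkl, zero_mul]
    · rw [← (hstep l).left_mul, ← mul_assoc, hWR' _ k l hkl, zero_mul]
    · rw [← (hstep l).mul_right, mul_assoc, hRW' _ k l hkl, mul_zero]
  have hd : ∀ i k, IsProjection (star (v i) * v i - R k i) := fun i k => by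
    rw [← hc]
    exact (hRp 0 i).sub (hRp k i) (hRR' i 0 k k.zero_le)
  choose D hD using fun i => exists_isProjSup hA (hd i)
  have hDc : ∀ i, D i * (star (v i) * v i) = D i := fun i => (hD i).mul_eq_self fun k => by
    rw [← hc, sub_mul, (hRp 0 i).2, hRR i 0 k k.zero_le]
  have hcD : ∀ i, star (v i) * v i * D i = D i := fun i => by
    rw [(hD i).isProjection.star_mul_eq (hv.isProjection i) (hDc i), (hD i).isProjection.1]
  set ρ : ℕ → A := fun i => star (v i) * v i - D i with hρ
  have hρp : ∀ i, IsProjection (ρ i) := fun i =>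
    (hv.isProjection i).sub (hD i).isProjection (hcD i)
  have hcρ : ∀ i, star (v i) * v i * ρ i = ρ i := fun i => by
    rw [hρ, mul_sub, (hv.isProjection i).2, hcD]
  have hρc : ∀ i, ρ i * (star (v i) * v i) = ρ i := fun i => by
    rw [(hv.isProjection i).star_mul_eq (hρp i) (hcρ i), (hρp i).1]
  have hρR : ∀ i k, ρ i * R k i = ρ i := fun i k => by
    have h1 : ρ i * (star (v i) * v i - R k i) = 0 := by
      have h2 : star (v i) * v i * (star (v i) * v i - R k i) = star (v i) * v i - R k i := by
        rw [← hc, mul_sub, (hRp 0 i).2, hRR' i 0 k k.zero_le]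
      rw [hρ, sub_mul, (hD i).mul_eq, h2, sub_self]
    rwa [mul_sub, hρc, sub_eq_zero, eq_comm] at h1
  have hRρ : ∀ i k, R k i * ρ i = ρ i := fun i k => by
    rw [(hρp i).star_mul_eq (hRp k i) (hρR i k), (hρp i).1]
  refine ⟨fun k => (Nat.unpair k).1, fun k => (Nat.unpair k).2, W, ρ,
    ⟨fun k => (hstep k).mul_star_mul, fun i j hij => ?_, fun i j hij => ?_⟩, fun i j => ?_,
    fun k => ?_, fun k => ?_, hρp, hcρ, fun i k => ?_, fun i k => ?_, fun i j hij => ?_,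
    fun i z hzc hzρ hzW hzW' => ?_⟩
  · rcases lt_or_gt_of_ne hij with h | h
    · exact (hWW i j h).2.2.1
    · simpa using congrArg star (hWW j i h).2.2.1
  · rcases lt_or_gt_of_ne hij with h | h
    · simpa using congrArg star (hWW i j h).2.2.2
    · exact (hWW j i h).2.2.2
  · rcases lt_trichotomy i j with h | rfl | h
    · exact (hWW i j h).2.1
    · exact (hstep i).mul_self
    · exact (hWW j i h).1
  · rw [← hc, ← (hstep k).left_mul, ← mul_assoc, hRR' _ 0 k k.zero_le]
  · rw [← hc, ← (hstep k).mul_right, mul_assoc, hRR _ 0 k k.zero_le]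
  · rw [← hρR i (k + 1), mul_assoc, (hstep k).rem_mul, mul_zero]
  · rw [← hRρ i (k + 1), ← mul_assoc, (hstep k).mul_rem, zero_mul]
  · have h1 := (hstep (Nat.pair i j)).corner (by simpa using hij)
    simp only [Nat.unpair_pair] at h1
    rw [← hρR i (Nat.pair i j + 1), ← hRρ j (Nat.pair i j + 1)]
    calc _ = ρ i * (R (Nat.pair i j + 1) i * v j * R (Nat.pair i j + 1) j) * ρ j := by
          simp only [mul_assoc]
      _ = 0 := by rw [h1, mul_zero, zero_mul]
  · have h1 : ∀ k, z * R k i = z := fun k => by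
      induction k with
      | zero => rw [hc, hzc]
      | succ k ih => exact (hstep k).eq_self i z ih (hzW k) (hzW' k)
    have h2 : z * D i = 0 := (hD i).eq_zero_left (hd i) fun k => by
      rw [mul_sub, hzc, h1, sub_self]
    rwa [hρ, mul_sub, hzc, h2, sub_zero] at hzρ

theorem OrthFam.star_mul_self_mul {v : ℕ → A} (n : ℕ → ℕ) {e : ℕ → A}
    (he : ∀ k, IsProjection (e k))
    (hc : ∀ k, star (v (n k)) * v (n k) * e k = e k) (k : ℕ) :
    star (v (n k) * e k) * (v (n k) * e k) = e k := by
  rw [star_mul, (he k).1, mul_assoc, ← mul_assoc (star _), hc, (he k).2]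

/-- Cutting down the members of an orthogonal family by orthogonal projections. -/
theorem OrthFam.mul_projection {v : ℕ → A} (hv : OrthFam v) (n : ℕ → ℕ) {e : ℕ → A}
    (he : ∀ k, IsProjection (e k)) (horth : ∀ i j, i ≠ j → e i * e j = 0)
    (hc : ∀ k, star (v (n k)) * v (n k) * e k = e k) : OrthFam fun k => v (n k) * e k where
  mul_star_mul k := by
    rw [OrthFam.star_mul_self_mul n he hc, mul_assoc, (he k).2]
  star_mul_eq_zero i j hij := by
    rw [star_mul, (he i).1, mul_assoc, ← mul_assoc (star _)]
    by_cases h : n i = n j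
    · rw [h, hc, horth i j hij]
    · rw [hv.star_mul_eq_zero _ _ h, zero_mul, mul_zero]
  mul_star_eq_zero i j hij := by
    rw [star_mul, (he j).1, mul_assoc, mul_mul_eq_zero (horth i j hij), mul_zero]

theorem IsMatching.rem_orthogonal {v : ℕ → A} {n m : ℕ → ℕ} {W ρ : ℕ → A} (hv : OrthFam v)
    (hM : IsMatching v n m W ρ) (i j : ℕ) (hij : i ≠ j) : ρ i * ρ j = 0 := by
  have h1 : ρ i * (star (v i) * v i) = ρ i := by
    rw [(hv.isProjection i).star_mul_eq (hM.isProjection i) (hM.left_mul_rem i),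
      (hM.isProjection i).1]
  rw [← h1, ← hM.left_mul_rem j, mul_assoc, mul_mul_eq_zero (hv.orthogonal i j hij), mul_zero]

theorem IsMatching.addable (hA : WeaklyRickart A) {v : ℕ → A} (hv : OrthFam v) {n m : ℕ → ℕ}
    {W ρ : ℕ → A} (hM : IsMatching v n m W ρ)
    (hl : Addable fun k => v (n k) * (W k * star (W k)))
    (hr : Addable fun k => v (m k) * (star (W k) * W k)) : Addable v := by
  have hW := hM.orthFam.mul_star_mul
  have hpl := fun k => isProjection_mul_star_self (hW k)
  have hpr := fun k => isProjection_star_mul_self (hW k)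
  have hcl : ∀ k, star (v (n k)) * v (n k) * (W k * star (W k)) = W k * star (W k) := fun k => by
    rw [← mul_assoc, hM.left_mul]
  have hWc : ∀ k, star (v (m k)) * v (m k) * star (W k) = star (W k) := fun k => by
    simpa [mul_assoc] using congrArg star (hM.mul_right k)
  have hcr : ∀ k, star (v (m k)) * v (m k) * (star (W k) * W k) = star (W k) * W k := fun k => by
    rw [← mul_assoc, hWc]
  have hWW' : ∀ i j, star (W i) * star (W j) = 0 := fun i j => by
    rw [← star_mul, hM.mul_eq_zero, star_zero]
  have hWρ : ∀ i k, star (W k) * ρ i = 0 := fun i k => by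
    simpa [(hM.isProjection i).1] using congrArg star (hM.rem_mul i k)
  have hρW : ∀ i k, ρ i * star (W k) = 0 := fun i k => by
    simpa [(hM.isProjection i).1] using congrArg star (hM.mul_rem i k)
  obtain ⟨S, hS, hS0⟩ : Addable fun i => v (id i) * ρ i :=
    (hv.mul_projection id hM.isProjection (hM.rem_orthogonal hv)
      hM.left_mul_rem).addable_of_pairwise_mul_eq_zero hA fun i j hij => by
        rw [mul_assoc, id, id, ← mul_assoc (ρ i), hM.corner i j hij, mul_zero]
  simp only [OrthFam.star_mul_self_mul id hM.isProjection hM.left_mul_rem] at hS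
  obtain ⟨T, hT, hT0⟩ := hl
  simp only [OrthFam.star_mul_self_mul n hpl hcl] at hT
  obtain ⟨U, hU, hU0⟩ := hr
  simp only [OrthFam.star_mul_self_mul m hpr hcr] at hU
  refine addable_of_mul_eq hA hv (u := S + T + U) fun i => ?_
  have hvc := hv.mul_star_mul i
  refine sub_eq_zero.1 (hM.eq_zero i _ ?_ ?_ (fun k => ?_) fun k => ?_)
  · rw [sub_mul, mul_assoc, (hv.isProjection i).2, hvc]
  · have h1 : T * ρ i = 0 := hT0 _ fun k => by rw [mul_assoc, mul_assoc, hWρ, mul_zero, mul_zero]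
    have h2 : U * ρ i = 0 := hU0 _ fun k => by
      rw [mul_assoc, mul_assoc, hM.mul_rem, mul_zero, mul_zero]
    rw [sub_mul, mul_assoc, hM.left_mul_rem, add_mul, add_mul, hS, h1, h2, add_zero, add_zero, id,
      sub_self]
  · by_cases h : i = n k
    · have h1 : S * W k = 0 := hS0 _ fun k => by rw [mul_assoc, hM.rem_mul, mul_zero]
      have h2 : U * W k = 0 := hU0 _ fun j => by
        rw [mul_assoc, mul_assoc, hM.mul_eq_zero, mul_zero, mul_zero]
      have h3 : T * W k = v (n k) * W k := by
        rw [← hW k, ← mul_assoc (W k), ← mul_assoc, hT, mul_assoc]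
      rw [h, sub_mul, mul_assoc, hM.left_mul, add_mul, add_mul, h1, h2, h3, zero_add, add_zero,
        sub_self]
    · have h1 : star (v i) * v i * W k = 0 := by
        rw [← hM.left_mul k, mul_mul_of_mul_eq (hv.orthogonal i (n k) h), zero_mul]
      rw [sub_mul, mul_assoc, h1, ← hvc, mul_assoc (v i), h1, mul_zero, mul_zero, sub_zero]
  · by_cases h : i = m k
    · have h1 : S * star (W k) = 0 := hS0 _ fun k => by rw [mul_assoc, hρW, mul_zero]
      have h2 : T * star (W k) = 0 := hT0 _ fun j => by
        rw [mul_assoc, mul_assoc, hWW', mul_zero, mul_zero]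
      have h3 : U * star (W k) = v (m k) * star (W k) := by
        rw [← star_mul_mul_star (hW k), ← mul_assoc (star (W k)), ← mul_assoc, hU, mul_assoc]
      rw [h, sub_mul, mul_assoc, hWc, add_mul, add_mul, h1, h2, h3, zero_add, zero_add, sub_self]
    · have h1 : star (v i) * v i * star (W k) = 0 := by
        rw [← hWc k, mul_mul_of_mul_eq (hv.orthogonal i (m k) h), zero_mul]
      rw [sub_mul, mul_assoc, h1, ← hvc, mul_assoc (v i), h1, mul_zero, mul_zero, sub_zero]

theorem IsProjSup.mul_mul_eq_zero {e : ℕ → A} {s x : A} (hs : IsProjSup e s)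
    (he : ∀ i, IsProjection (e i)) (hx : ∀ i j, e i * (x * e j) = 0) : s * (x * s) = 0 :=
  hs.mul_eq_zero _ fun i => by
    rw [← mul_assoc]
    exact hs.eq_zero_left he fun j => by rw [mul_assoc, hx]

theorem IsProjSup.mul_eq_self_of_forall {e : ℕ → A} {s u : A} (hs : IsProjSup e s)
    (hu : ∀ z, (∀ i, e i * z = 0) → u * z = 0) (he : ∀ i, IsProjection (e i)) : u * s = u := by
  have h1 : u * (star (u - u * s) - s * star (u - u * s)) = 0 := hu _ fun i => by
    rw [mul_sub, ← mul_assoc, hs.mul_eq_right he, sub_self]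
  rw [mul_sub, ← mul_assoc, ← sub_mul] at h1
  exact (sub_eq_zero.1 ((CStarRing.mul_star_self_eq_zero_iff _).1 h1)).symm

theorem OrthFam.star_mul_eq {v w : ℕ → A} (hv : OrthFam v) (hw : OrthFam w)
    (hvw : ∀ i, star (v i) * v i = star (w i) * w i) (i j : ℕ) :
    star (v i) * v j = star (w i) * w j := by
  rcases eq_or_ne i j with rfl | hij
  · exact hvw i
  · rw [hv.star_mul_eq_zero i j hij, hw.star_mul_eq_zero i j hij]

/-- The sum of an addable family can be chosen as a partial isometry whose initial projection is
the supremum of the initial projections. -/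
theorem Addable.exists_sum {v : ℕ → A} (hadd : Addable v) (hv : OrthFam v) {s : A}
    (hs : IsProjSup (fun i => star (v i) * v i) s) :
    ∃ u, (∀ i, u * (star (v i) * v i) = v i) ∧ u * s = u ∧ star u * u = s := by
  obtain ⟨u, hu, hu0⟩ := hadd
  have hus : u * s = u := hs.mul_eq_self_of_forall (fun z hz => hu0 z fun i => by
    rw [← hv.mul_star_mul, mul_assoc, hz, mul_zero]) hv.isProjection
  have hsu : s * star u = star u := by simpa [hs.isProjection.1] using congrArg star hus
  refine ⟨u, hu, hus, ?_⟩
  have key : s * ((star u * u - s) * s) = 0 :=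
    hs.mul_mul_eq_zero hv.isProjection fun i j => by
      have h1 : star (v i) * v i * (star u * u * (star (v j) * v j)) = star (v i) * v j := by
        have h2 : star (v i) * v i * star u = star (v i) := by
          simpa [mul_assoc] using congrArg star (hu i)
        rw [mul_assoc (star u), hu, ← mul_assoc, h2]
      rw [sub_mul, mul_sub, h1, hs.mul_eq]
      rcases eq_or_ne i j with rfl | hij
      · rw [(hv.isProjection i).2, sub_self]
      · rw [hv.orthogonal i j hij, hv.star_mul_eq_zero i j hij, sub_self]
  rw [sub_mul, mul_sub, mul_assoc, hus, ← mul_assoc, hsu, hs.isProjection.2, hs.isProjection.2,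
    sub_eq_zero] at key
  exact key

theorem OrthFam.exists_weighted_sum {v : ℕ → A} (hv : OrthFam v) {s : A}
    (hs : IsProjSup (fun i => star (v i) * v i) s) :
    ∃ y h : A, IsSelfAdjoint h ∧ star y * y = h * h ∧ y * s = y ∧
      (∀ i, y * (star (v i) * v i) = (2⁻¹ : ℝ) ^ i • v i) ∧
      ∀ i, h * (star (v i) * v i) = (2⁻¹ : ℝ) ^ i • (star (v i) * v i) := by
  have hvsum := summable_geometric_smul fun i => norm_le_one_of_mul_star_mul (hv.mul_star_mul i)
  have hcsum := summable_geometric_smul fun i => (hv.isProjection i).norm_le_one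
  set y : A := ∑' i, (2⁻¹ : ℝ) ^ i • v i with hy
  set h : A := ∑' i, (2⁻¹ : ℝ) ^ i • (star (v i) * v i) with hh
  have hvs : ∀ i, v i * s = v i := fun i => by
    rw [← hv.mul_star_mul, mul_assoc, hs.mul_eq_right hv.isProjection]
  have hys : y * s = y := by
    rw [hy, ← hvsum.tsum_mul_right]
    simp only [smul_mul_assoc, hvs]
  have hhs : h * s = h := by
    rw [hh, ← hcsum.tsum_mul_right]
    simp only [smul_mul_assoc, hs.mul_eq_right hv.isProjection]
  have hyc : ∀ i, y * (star (v i) * v i) = (2⁻¹ : ℝ) ^ i • v i := fun i => by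
    rw [hy, ← hvsum.tsum_mul_right, tsum_eq_single i fun j hj => ?_, smul_mul_assoc,
      hv.mul_star_mul]
    rw [smul_mul_assoc, _root_.mul_mul_eq_zero (hv.mul_star_eq_zero j i hj), smul_zero]
  have hhc : ∀ i, h * (star (v i) * v i) = (2⁻¹ : ℝ) ^ i • (star (v i) * v i) := fun i => by
    rw [hh, ← hcsum.tsum_mul_right, tsum_eq_single i fun j hj => ?_, smul_mul_assoc,
      (hv.isProjection i).2]
    rw [smul_mul_assoc, hv.orthogonal j i hj, smul_zero]
  have hha : IsSelfAdjoint h := by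
    rw [isSelfAdjoint_iff, hh, tsum_star]
    simp only [star_smul, star_mul, star_star, star_trivial]
  have hsy : s * star y = star y := by simpa [hs.isProjection.1] using congrArg star hys
  have hsh : s * h = h := by simpa [hs.isProjection.1, hha.star_eq] using congrArg star hhs
  have hcy : ∀ i, star (v i) * v i * star y = (2⁻¹ : ℝ) ^ i • star (v i) := fun i => by
    simpa [mul_assoc] using congrArg star (hyc i)
  have hch : ∀ i, star (v i) * v i * h = (2⁻¹ : ℝ) ^ i • (star (v i) * v i) := fun i => by
    simpa [mul_assoc, hha.star_eq] using congrArg star (hhc i)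
  have key : s * ((star y * y - h * h) * s) = 0 :=
    hs.mul_mul_eq_zero hv.isProjection fun i j => by
      rw [sub_mul, mul_sub, mul_assoc (star y), hyc, ← mul_assoc, hcy, mul_assoc h, hhc,
        ← mul_assoc (star (v i) * v i) h, hch]
      simp only [smul_mul_assoc, mul_smul_comm]
      rcases eq_or_ne i j with rfl | hij
      · rw [(hv.isProjection i).2, sub_self]
      · rw [hv.orthogonal i j hij, hv.star_mul_eq_zero i j hij, sub_self]
  refine ⟨y, h, hha, ?_, hys, hyc, hhc⟩
  rw [sub_mul, mul_sub, mul_assoc, hys, ← mul_assoc, hsy, mul_assoc, hhs, ← mul_assoc, hsh,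
    sub_eq_zero] at key
  exact key

theorem IsSelfAdjoint.exists_polar_of_mul_self_eq_zero (hA : WeaklyRickart A) {h y : A}
    (hh : IsSelfAdjoint h) (hy : star y * y = h * h) (hyy : y * y = 0) : ∃ u, u * h = y := by
  obtain ⟨p, hp⟩ := hA h
  obtain ⟨u, hu⟩ := exists_isPolar_of_mul_self_eq_zero hA hh hy hyy hp
  exact ⟨u, hu.mul_eq⟩

/-- A factorization of `y` through `h`, given two partial isometries with initial projection
`s` and orthogonal final projections that are also orthogonal to `s`. -/
theorem exists_mul_eq_of_two_copies (hA : WeaklyRickart A) {y h s J K : A}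
    (hh : IsSelfAdjoint h) (hy : star y * y = h * h) (hys : y * s = y)
    (hJs : J * s = J) (hKs : K * s = K) (hJ : star J * J = s) (hK : star K * K = s)
    (hsJ : s * J = 0) (hsK : s * K = 0) (hJK : star J * K = 0) (hsp : IsProjection s) :
    ∃ u, u * h = y := by
  have hsJ' : s * star J = star J := by simpa [hsp.1] using congrArg star hJs
  have hsK' : s * star K = star K := by simpa [hsp.1] using congrArg star hKs
  have hKJ : star K * J = 0 := by simpa using congrArg star hJK
  have hJr : star J * (J * star J) = star J := by rw [← mul_assoc, hJ, hsJ']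
  have hyJ : y * J = 0 := by rw [← hys, mul_assoc, hsJ, mul_zero]
  set y₁ : A := y - J * star J * y with hy₁
  set y₂ : A := J * star J * y with hy₂
  have hJy₁ : star J * y₁ = 0 := by
    rw [hy₁, mul_sub, ← mul_assoc, hJr, sub_self]
  have hsum : star y₁ * y₁ + star y₂ * y₂ = h * h := by
    have hrr : J * (star J * (J * (star J * y))) = J * (star J * y) := by
      rw [← mul_assoc (star J) J, hJ, ← mul_assoc s, hsJ']
    rw [← hy, hy₁, hy₂]
    simp only [star_sub, star_mul, star_star, sub_mul, mul_sub, mul_assoc, hrr]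
    abel
  have hy₁s : y₁ * s = y₁ := by rw [hy₁, sub_mul, mul_assoc, hys]
  have hy₂s : y₂ * s = y₂ := by rw [hy₂, mul_assoc, hys]
  obtain ⟨a, ha, haa⟩ := exists_mul_self_eq_star_mul_self y₁
  obtain ⟨b, hb, hbb⟩ := exists_mul_self_eq_star_mul_self y₂
  have has : a * s = a := mul_eq_of_forall_mul_eq_zero
    (fun z hz => mul_eq_zero_of_star_mul_self_eq (by rw [ha.star_eq, haa]) hz) hy₁s
  have hbs : b * s = b := mul_eq_of_forall_mul_eq_zero
    (fun z hz => mul_eq_zero_of_star_mul_self_eq (by rw [hb.star_eq, hbb]) hz) hy₂s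
  have hsa : s * a = a := by simpa [hsp.1, ha.star_eq] using congrArg star has
  have hsb : s * b = b := by simpa [hsp.1, hb.star_eq] using congrArg star hbs
  have hmJ : ∀ z, star J * (J * z) = s * z := mul_mul_of_mul_eq hJ
  have hmK : ∀ z, star K * (K * z) = s * z := mul_mul_of_mul_eq hK
  have hJa : IsSelfAdjoint (J * a * star J) := by
    rw [isSelfAdjoint_iff, star_mul, star_mul, star_star, ha.star_eq, mul_assoc]
  obtain ⟨U, hU⟩ := hJa.exists_polar_of_mul_self_eq_zero hA (y := y₁ * star J)
    (by
      calc star (y₁ * star J) * (y₁ * star J) = J * (star y₁ * y₁) * star J := by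
            simp only [star_mul, star_star, mul_assoc]
        _ = J * a * star J * (J * a * star J) := by
            rw [← haa]
            simp only [mul_assoc, hmJ]
            rw [← mul_assoc s a, hsa])
    (by rw [mul_assoc, ← mul_assoc (star J), hJy₁, zero_mul, mul_zero])
  obtain ⟨U', hU'⟩ := hb.exists_polar_of_mul_self_eq_zero hA (y := y₂) hbb.symm
    (by rw [hy₂]; simp only [mul_assoc]; rw [_root_.mul_mul_eq_zero hyJ, mul_zero, mul_zero])
  have haJ : a * J = 0 := by rw [← has, mul_assoc, hsJ, mul_zero]
  have haK : a * K = 0 := by rw [← has, mul_assoc, hsK, mul_zero]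
  have hbJ : b * J = 0 := by rw [← hbs, mul_assoc, hsJ, mul_zero]
  have hbK : b * K = 0 := by rw [← hbs, mul_assoc, hsK, mul_zero]
  obtain ⟨V, hV⟩ := hh.exists_polar_of_mul_self_eq_zero hA (y := J * a + K * b)
    (by
      rw [← hsum, ← haa, ← hbb]
      simp only [star_add, star_mul, ha.star_eq, hb.star_eq, add_mul, mul_add, mul_assoc,
        _root_.mul_mul_eq_zero hJK, _root_.mul_mul_eq_zero hKJ, hmJ, hmK, hsa, hsb, mul_zero,
        add_zero, zero_add])
    (by simp only [add_mul, mul_add, mul_assoc, _root_.mul_mul_eq_zero haJ,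
          _root_.mul_mul_eq_zero haK, _root_.mul_mul_eq_zero hbJ, _root_.mul_mul_eq_zero hbK,
          mul_zero, add_zero])
  have hUJ : U * (J * a) = y₁ := by
    have h1 := congrArg (· * J) hU
    simp only [mul_assoc, hJ, has, hy₁s] at h1
    exact h1
  refine ⟨U * (J * (star J * V)) + U' * (star K * V), ?_⟩
  simp only [add_mul, mul_assoc, hV, mul_add, hmJ, hmK, hsa, hsb, _root_.mul_mul_eq_zero hJK,
    _root_.mul_mul_eq_zero hKJ, add_zero, zero_add, hUJ, hU']
  exact sub_add_cancel _ _

theorem OrthFam.addable_of_two_copies (hA : WeaklyRickart A) {v α β : ℕ → A} (hv : OrthFam v)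
    (hα : OrthFam α) (hβ : OrthFam β) (hvα : ∀ i, star (α i) * α i = star (v i) * v i)
    (hvβ : ∀ i, star (β i) * β i = star (v i) * v i)
    (hcα : ∀ i j, star (v i) * v i * α j = 0) (hcβ : ∀ i j, star (v i) * v i * β j = 0)
    (hαβ : ∀ i j, star (α i) * β j = 0) : Addable v := by
  obtain ⟨s, hs⟩ := exists_isProjSup hA hv.isProjection
  have hαα : ∀ i j, α i * α j = 0 := fun i j => by
    rw [← hα.mul_star_mul i, hvα, mul_assoc, hcα, mul_zero]
  have hββ : ∀ i j, β i * β j = 0 := fun i j => by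
    rw [← hβ.mul_star_mul i, hvβ, mul_assoc, hcβ, mul_zero]
  obtain ⟨J, hJα, hJs, hJ⟩ :=
    (hα.addable_of_mul_eq_zero hA hαα).exists_sum hα (s := s) (by simpa only [hvα] using hs)
  obtain ⟨K, hKβ, hKs, hK⟩ :=
    (hβ.addable_of_mul_eq_zero hA hββ).exists_sum hβ (s := s) (by simpa only [hvβ] using hs)
  simp only [hvα] at hJα
  simp only [hvβ] at hKβ
  have hsJ : s * J = 0 := by
    have := hs.mul_mul_eq_zero hv.isProjection (x := J) fun i j => by rw [hJα, hcα]
    rwa [hJs] at this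
  have hsK : s * K = 0 := by
    have := hs.mul_mul_eq_zero hv.isProjection (x := K) fun i j => by rw [hKβ, hcβ]
    rwa [hKs] at this
  have hsJ' : s * star J = star J := by simpa [hs.isProjection.1] using congrArg star hJs
  have hJK : star J * K = 0 := by
    have := hs.mul_mul_eq_zero hv.isProjection (x := star J * K) fun i j => by
      have h1 : star (v i) * v i * star J = star (α i) := by
        simpa [mul_assoc] using congrArg star (hJα i)
      rw [mul_assoc (star J), hKβ, ← mul_assoc, h1, hαβ]
    rwa [mul_assoc (star J), hKs, ← mul_assoc, hsJ'] at this
  obtain ⟨y, h, hh, hy, hys, hyc, hhc⟩ := hv.exists_weighted_sum hs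
  obtain ⟨u, hu⟩ :=
    exists_mul_eq_of_two_copies hA hh hy hys hJs hKs hJ hK hsJ hsK hJK hs.isProjection
  refine addable_of_mul_eq hA hv (u := u) fun i => ?_
  have h1 : (2⁻¹ : ℝ) ^ i • (u * (star (v i) * v i)) = (2⁻¹ : ℝ) ^ i • v i := by
    rw [← mul_smul_comm, ← hhc, ← mul_assoc, hu, hyc]
  exact smul_right_injective A (by positivity : (2⁻¹ : ℝ) ^ i ≠ 0) h1

theorem OrthFam.star_family {v : ℕ → A} (hv : OrthFam v) : OrthFam fun i => star (v i) where
  mul_star_mul i := by rw [star_star, star_mul_mul_star (hv.mul_star_mul i)]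
  star_mul_eq_zero i j hij := by rw [star_star, hv.mul_star_eq_zero i j hij]
  mul_star_eq_zero i j hij := by rw [star_star, hv.star_mul_eq_zero i j hij]

theorem OrthFam.addable_of_copy (hA : WeaklyRickart A) {v w : ℕ → A} (hv : OrthFam v)
    (hw : OrthFam w) (hvw : ∀ i, star (w i) * w i = star (v i) * v i)
    (hmul : ∀ i j, v i * w j = 0) : Addable v := by
  have key : ∀ (n : ℕ → ℕ) (α : ℕ → A), OrthFam α → (∀ i j, α i * α j = 0) →
      (∀ i j, α i * w j = 0) → (∀ i j, star (α i) * w j = 0) →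
      (∀ k, star (v (n k)) * v (n k) * (star (α k) * α k) = star (α k) * α k) →
      Addable fun k => v (n k) * (star (α k) * α k) := by
    intro n α hα hαα hαw hαw' hc
    have hc' : ∀ k, star (w (n k)) * w (n k) * (star (α k) * α k) =
        star (α k) * α k := fun k => by rw [hvw, hc]
    have e1 := OrthFam.star_mul_self_mul n hα.isProjection hc
    have e2 := OrthFam.star_mul_self_mul n hα.isProjection hc'
    refine (hv.mul_projection n hα.isProjection hα.orthogonal hc).addable_of_two_copies hA hα
      (hw.mul_projection n hα.isProjection hα.orthogonal hc') (fun i => (e1 i).symm)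
      (fun i => (e2 i).trans (e1 i).symm) (fun i j => ?_) (fun i j => ?_) fun i j => ?_
    · rw [e1, mul_assoc, hαα, mul_zero]
    · rw [e1, mul_assoc, ← mul_assoc (α i), hαw, zero_mul, mul_zero]
    · rw [← mul_assoc, hαw', zero_mul]
  obtain ⟨n, m, W, ρ, hM⟩ := hv.exists_isMatching hA
  have hWw : ∀ i j, W i * w j = 0 := fun i j => by
    rw [← hM.mul_right, mul_assoc, mul_assoc, hmul, mul_zero, mul_zero]
  have hWw' : ∀ i j, star (W i) * w j = 0 := fun i j => by
    rw [← hM.left_mul i, star_mul, star_mul, star_star, mul_assoc, mul_assoc, hmul, mul_zero,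
      mul_zero]
  refine hM.addable hA hv ?_ (key m W hM.orthFam hM.mul_eq_zero hWw hWw' fun k => ?_)
  · simpa only [star_star] using key n (fun k => star (W k)) hM.orthFam.star_family
      (fun i j => by rw [← star_mul, hM.mul_eq_zero, star_zero]) hWw'
      (fun i j => by rw [star_star, hWw])
      (fun k => by rw [star_star, ← mul_assoc, hM.left_mul])
  · have h1 : star (v (m k)) * v (m k) * star (W k) = star (W k) := by
      simpa [mul_assoc] using congrArg star (hM.mul_right k)
    rw [← mul_assoc, h1]

theorem OrthFam.addable (hA : WeaklyRickart A) {v : ℕ → A} (hv : OrthFam v) : Addable v := by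
  have key : ∀ (n : ℕ → ℕ) (α : ℕ → A), OrthFam α → (∀ i j, α i * α j = 0) →
      (∀ k, star (v (n k)) * v (n k) * (star (α k) * α k) = star (α k) * α k) →
      Addable fun k => v (n k) * (star (α k) * α k) := by
    intro n α hα hαα hc
    refine (hv.mul_projection n hα.isProjection hα.orthogonal hc).addable_of_copy hA hα
      (fun i => (OrthFam.star_mul_self_mul n hα.isProjection hc i).symm) fun i j => ?_
    rw [mul_assoc, mul_assoc, hαα, mul_zero, mul_zero]
  obtain ⟨n, m, W, ρ, hM⟩ := hv.exists_isMatching hA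
  refine hM.addable hA hv ?_ (key m W hM.orthFam hM.mul_eq_zero fun k => ?_)
  · simpa only [star_star] using key n (fun k => star (W k)) hM.orthFam.star_family
      (fun i j => by rw [← star_mul, hM.mul_eq_zero, star_zero])
      (fun k => by rw [star_star, ← mul_assoc, hM.left_mul])
  · have h1 : star (v (m k)) * v (m k) * star (W k) = star (W k) := by
      simpa [mul_assoc] using congrArg star (hM.mul_right k)
    rw [← mul_assoc, h1]

end

/-- In a weakly Rickart C*-algebra, the annihilating left projection `LP(x)` and the
annihilating right projection `RP(x)` of any element `x` are Murray–von Neumann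
equivalent: there is a partial isometry `e` with `e e* = LP(x)` and `e* e = RP(x)`. -/
theorem lp_rp_murray_von_neumann_equivalent {A : Type*} [NonUnitalCStarAlgebra A]
    (hA : WeaklyRickart A) (x : A) :
    ∃ p q e : A, IsARP x p ∧ IsALP x q ∧ IsPartialIsometry e ∧
      e * star e = q ∧ star e * e = p := by
  obtain ⟨h, hh, hhx⟩ := exists_mul_self_eq_star_mul_self x
  obtain ⟨p, hp⟩ := hA h
  obtain ⟨c, k, hs⟩ := exists_isSpectralPartition hA hh
  obtain ⟨e, he⟩ := hs.exists_isPolar hh hhx.symm ((hs.orthFam hhx.symm).addable hA) hp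
  have hhs : star h * h = star x * x := by rw [hh.star_eq, hhx]
  have hee : e * (star e * e) = e := by rw [he.star_mul_self, he.mul_supp]
  have hq := isProjection_mul_star_self hee
  refine ⟨p, e * star e, e, ⟨hp.1, ?_, fun y hy => hp.2.2 y ?_⟩, ⟨hq, ?_, fun y hy => ?_⟩, hq, rfl,
    he.star_mul_self⟩
  · exact mul_eq_of_forall_mul_eq_zero
      (fun z hz => mul_eq_zero_of_star_mul_self_eq hhs.symm hz) hp.2.1
  · exact mul_eq_zero_of_star_mul_self_eq hhs hy
  · rw [← he.mul_eq, ← mul_assoc, mul_assoc e, hee]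
  · rw [← he.mul_eq, ← mul_assoc] at hy
    have h1 := hp.mul_eq_zero_left hh hy
    rw [mul_assoc, he.mul_supp] at h1
    rw [← mul_assoc, h1, zero_mul]
end

section
/- Let y be an element of a C*-algebra A. Then the intersection of the norm closures of the sets {a y : a ∈ A} and {y* a : a ∈ A} equals the norm closure of {y* y a y* y : a ∈ A}, i.e. the inner ideal A(y* y) of A generated by y* y. -/
/-- Regularized inverses of `star y * y` give contractive approximate right units for `y`. -/
lemma exists_isSelfAdjoint_norm_sub_mul_le {A : Type*} [NonUnitalCStarAlgebra A] (y : A)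
    {δ : ℝ} (hδ : 0 < δ) :
    ∃ b : A, IsSelfAdjoint b ∧ Commute b (star y * y) ∧ ‖b * (star y * y)‖ ≤ 1 ∧
      ‖y - y * (b * (star y * y))‖ ≤ δ := by
  have hh : IsSelfAdjoint (star y * y) := .star_mul_self y
  set h := star y * y with h_def
  have hpos (t : ℝ) : 0 < t ^ 2 + (δ ^ 2) ^ 2 := by positivity
  have hg : Continuous fun t : ℝ ↦ t / (t ^ 2 + (δ ^ 2) ^ 2) :=
    continuous_id.div (by fun_prop) fun t ↦ (hpos t).ne'
  set g : ℝ → ℝ := fun t ↦ t / (t ^ 2 + (δ ^ 2) ^ 2) with g_def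
  have hg0 : g 0 = 0 := by simp [g_def]
  have he : cfcₙ g h * h = cfcₙ (fun t ↦ g t * t) h := by
    rw [cfcₙ_mul g (fun t ↦ t) h hg.continuousOn hg0 continuousOn_id rfl, cfcₙ_id' ℝ h]
  have hsa : IsSelfAdjoint (cfcₙ g h * h) := he ▸ cfcₙ_predicate _ h
  have hcomm : Commute (cfcₙ g h) h := by
    simpa only [cfcₙ_id' ℝ h] using cfcₙ_commute_cfcₙ g (fun t ↦ t) h
  refine ⟨cfcₙ g h, cfcₙ_predicate g h, hcomm, ?_, ?_⟩
  · rw [he]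
    refine norm_cfcₙ_le fun t _ ↦ ?_
    rw [g_def, Real.norm_eq_abs, div_mul_eq_mul_div, abs_of_nonneg (div_nonneg (mul_self_nonneg t) (hpos t).le),
      div_le_one (hpos t)]
    nlinarith [sq_nonneg (δ ^ 2)]
  · refine le_of_sq_le_sq ?_ hδ.le
    have key : star (y - y * (cfcₙ g h * h)) * (y - y * (cfcₙ g h * h)) =
        cfcₙ (fun t ↦ t - g t * t * t - (t - g t * t * t) * (g t * t)) h := by
      have h1 : cfcₙ (fun t ↦ t - g t * t * t) h = h - cfcₙ g h * h * h := by
        rw [cfcₙ_sub (fun t ↦ t) (fun t ↦ g t * t * t) h (by fun_prop) rfl (by fun_prop)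
          (by simp), cfcₙ_mul (fun t ↦ g t * t) (fun t ↦ t) h (by fun_prop) (by simp)
          (by fun_prop) rfl, cfcₙ_id' ℝ h, he]
      rw [cfcₙ_sub (fun t ↦ t - g t * t * t) (fun t ↦ (t - g t * t * t) * (g t * t)) h
        (by fun_prop) (by simp) (by fun_prop) (by simp),
        cfcₙ_mul (fun t ↦ t - g t * t * t) (fun t ↦ g t * t) h
        (by fun_prop) (by simp) (by fun_prop) (by simp), h1, ← he, star_sub, star_mul, hsa.star_eq]
      simp only [sub_mul, mul_sub, h_def, mul_assoc]
    rw [sq, ← CStarRing.norm_star_mul_self, key]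
    refine norm_cfcₙ_le fun t _ ↦ ?_
    have : t - g t * t * t - (t - g t * t * t) * (g t * t) =
        t * (δ ^ 2) ^ 4 / (t ^ 2 + (δ ^ 2) ^ 2) ^ 2 := by
      have := (hpos t).ne'
      simp only [g_def]
      field_simp
      ring
    rw [this, Real.norm_eq_abs, abs_div, abs_mul, abs_of_pos (pow_pos (hpos t) 2),
      div_le_iff₀ (pow_pos (hpos t) 2), abs_of_pos (by positivity : 0 < (δ ^ 2) ^ 4)]
    have hd : 0 < δ ^ 2 := by positivity
    rw [← sq_abs t]
    generalize |t| = s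
    generalize δ ^ 2 = d at hd
    have : 0 ≤ d * (s ^ 4 + d ^ 2 * s ^ 2 + d ^ 2 * (s - d / 2) ^ 2 + 3 / 4 * d ^ 4) := by
      positivity
    nlinarith

/-- A contractive approximate right unit for `y` is also one for the closure of `A y`. -/
lemma norm_sub_mul_lt_of_norm_sub_lt {A : Type*} [NonUnitalNormedRing A] {y z a e : A} {ε : ℝ}
    (he : ‖e‖ ≤ 1) (hz : ‖z - a * y‖ < ε) (hy : ‖a‖ * ‖y - y * e‖ ≤ ε) :
    ‖z - z * e‖ < 3 * ε := by
  have h1 : ‖(z - a * y) * e‖ ≤ ‖z - a * y‖ :=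
    (norm_mul_le _ _).trans (mul_le_of_le_one_right (norm_nonneg _) he)
  calc ‖z - z * e‖ = ‖(z - a * y) + a * (y - y * e) - (z - a * y) * e‖ := by
        congr 1; noncomm_ring
    _ ≤ ‖z - a * y‖ + ‖a * (y - y * e)‖ + ‖(z - a * y) * e‖ :=
        (norm_sub_le _ _).trans (by gcongr; exact norm_add_le _ _)
    _ < 3 * ε := by linarith [norm_mul_le a (y - y * e)]

/-- For an element `y` of a C*-algebra `A`, the intersection of the norm closures of
`A y = {a * y : a ∈ A}` and `y* A = {y* * a : a ∈ A}` equals the norm closure of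
`(y* y) A (y* y)`, i.e. the inner ideal `A(y* y)` of `A` generated by `y* y`. -/
theorem closure_left_inter_closure_right_eq_innerIdeal
    {A : Type*} [NonUnitalCStarAlgebra A] (y : A) :
    closure {z : A | ∃ a : A, z = a * y} ∩ closure {z : A | ∃ a : A, z = star y * a}
      = closure {z : A | ∃ a : A, z = (star y * y) * a * (star y * y)} := by
  apply Set.Subset.antisymm
  · rintro z ⟨hl, hr⟩
    rw [Metric.mem_closure_iff] at hl hr ⊢
    intro ε hε
    obtain ⟨_, ⟨a, rfl⟩, ha⟩ := hl (ε / 6) (by positivity)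
    obtain ⟨_, ⟨c, rfl⟩, hc⟩ := hr (ε / 6) (by positivity)
    rw [dist_eq_norm] at ha hc
    have hM : 0 < ‖a‖ + ‖c‖ + 1 := by positivity
    obtain ⟨b, hb, hcomm, he, hy⟩ :=
      exists_isSelfAdjoint_norm_sub_mul_le y (δ := ε / 6 / (‖a‖ + ‖c‖ + 1)) (by positivity)
    have hbound {r : ℝ} (hr : 0 ≤ r) (hrM : r ≤ ‖a‖ + ‖c‖ + 1) :
        r * ‖y - y * (b * (star y * y))‖ ≤ ε / 6 :=
      calc _ ≤ (‖a‖ + ‖c‖ + 1) * (ε / 6 / (‖a‖ + ‖c‖ + 1)) := by gcongr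
        _ = ε / 6 := mul_div_cancel₀ _ hM.ne'
    have hes : star (b * (star y * y)) = b * (star y * y) :=
      (hb.commute_iff (.star_mul_self y)).mp hcomm
    have h1 := norm_sub_mul_lt_of_norm_sub_lt he ha
      (hbound (norm_nonneg a) (by linarith [norm_nonneg c]))
    have h2 : ‖star z - star z * (b * (star y * y))‖ < 3 * (ε / 6) := by
      refine norm_sub_mul_lt_of_norm_sub_lt (a := star c) he ?_
        (hbound (norm_nonneg _) (by rw [norm_star]; linarith [norm_nonneg a]))
      rwa [← norm_star, star_sub, star_mul, star_star, star_star]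
    rw [← norm_star, star_sub, star_mul, star_star, hes] at h2
    refine ⟨_, ⟨b * z * b, rfl⟩, ?_⟩
    have h3 : star y * y * (b * z * b) * (star y * y) =
        b * (star y * y) * z * (b * (star y * y)) := by
      rw [hcomm.eq]; simp only [mul_assoc]; rw [hcomm.eq]; simp only [mul_assoc]
    rw [dist_eq_norm, h3]
    generalize b * (star y * y) = e at *
    calc ‖z - e * z * e‖ = ‖(z - z * e) + (z - e * z) * e‖ := by congr 1; noncomm_ring
      _ ≤ ‖z - z * e‖ + ‖z - e * z‖ * ‖e‖ :=
        (norm_add_le _ _).trans (by gcongr; exact norm_mul_le _ _)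
      _ ≤ ‖z - z * e‖ + ‖z - e * z‖ := by
        gcongr; exact mul_le_of_le_one_right (norm_nonneg _) he
      _ < ε := by linarith
  · refine Set.subset_inter (closure_mono ?_) (closure_mono ?_)
    · rintro _ ⟨a, rfl⟩
      exact ⟨star y * y * a * star y, by simp only [mul_assoc]⟩
    · rintro _ ⟨a, rfl⟩
      exact ⟨y * a * (star y * y), by simp only [mul_assoc]⟩
end

section
/- Let A be a C*-algebra such that for every pair of elements x, y ∈ A with x ⊥ y there exists a partial isometry e ∈ A with A(x) ⊆ A₂(e) and A(y) ⊆ A₀(e). Then A is an SAW*-algebra. -/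
/-- The Peirce-2 subspace associated with a partial isometry `e`. -/
def Peirce2 {A : Type*} [Mul A] [Star A] (e : A) : Set A :=
  {z : A | e * star e * z * (star e * e) = z}

/-- The Peirce-0 subspace associated with a partial isometry `e`. -/
def Peirce0 {A : Type*} [Mul A] [Star A] [Zero A] (e : A) : Set A :=
  {z : A | e * star e * z = 0 ∧ z * (star e * e) = 0}

/-- Orthogonality of elements in a C*-algebra: `a ⊥ b` iff `a b* = 0` and `b* a = 0`. -/
def Orthog {A : Type*} [Mul A] [Star A] [Zero A] (a b : A) : Prop :=
  a * star b = 0 ∧ star b * a = 0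

/-- The inner ideal of `A` generated by `x`: the norm closure of `x A x`. -/
def innerIdealGen {A : Type*} [NonUnitalCStarAlgebra A] (x : A) : Set A :=
  closure {z : A | ∃ a : A, z = x * a * x}

/-- A C*-algebra is an SAW*-algebra if for any two orthogonal positive elements `x, y`
there is a positive element `e` with `e x = x` and `e y = 0`. -/
def IsSAWStar (A : Type*) [NonUnitalCStarAlgebra A] [PartialOrder A] : Prop :=
  ∀ x y : A, 0 ≤ x → 0 ≤ y → x * y = 0 →
    ∃ e : A, 0 ≤ e ∧ e * x = x ∧ e * y = 0

/-- A C*-algebra is semiprime: an element `w` with `w A w* = 0` vanishes. -/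
theorem eq_zero_of_forall_mul_mul_star_eq_zero {A : Type*} [NonUnitalCStarAlgebra A] {w : A}
    (hw : ∀ a : A, w * a * star w = 0) : w = 0 := by
  rw [← CStarRing.mul_star_self_eq_zero_iff, ← CStarRing.mul_star_self_eq_zero_iff]
  simpa [mul_assoc] using hw (star w * w)

/-- Every `x * a * x` lies in the inner ideal generated by `x`. -/
theorem mul_mul_mem_innerIdealGen {A : Type*} [NonUnitalCStarAlgebra A] (x a : A) :
    x * a * x ∈ innerIdealGen x :=
  subset_closure ⟨a, rfl⟩

/-- If for every pair of orthogonal elements `x ⊥ y` of a C*-algebra `A` there is a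
partial isometry `e` with `A(x) ⊆ A₂(e)` and `A(y) ⊆ A₀(e)`, then `A` is an
SAW*-algebra. -/
theorem sawstar_of_peirce_condition {A : Type*} [NonUnitalCStarAlgebra A]
    [PartialOrder A] [StarOrderedRing A]
    (h : ∀ x y : A, Orthog x y →
      ∃ e : A, IsPartialIsometry e ∧
        innerIdealGen x ⊆ Peirce2 e ∧ innerIdealGen y ⊆ Peirce0 e) :
    IsSAWStar A := by
  intro x y hx hy hxy
  have hx' : star x = x := (IsSelfAdjoint.of_nonneg hx).star_eq
  have hy' : star y = y := (IsSelfAdjoint.of_nonneg hy).star_eq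
  have hyx : y * x = 0 := by simpa [hx', hy'] using congrArg star hxy
  obtain ⟨e, ⟨hp, hpp⟩, h2, h0⟩ := h x y ⟨by rwa [hy'], by rwa [hy']⟩
  refine ⟨e * star e, mul_star_self_nonneg e, ?_, ?_⟩
  · rw [← sub_eq_zero]
    refine eq_zero_of_forall_mul_mul_star_eq_zero fun a => ?_
    have hz : e * star e * (x * a * x) * (star e * e) = x * a * x :=
      h2 (mul_mul_mem_innerIdealGen x a)
    have hpz : e * star e * (x * a * x) = x * a * x := by
      rw [← hz]
      simp only [← mul_assoc] at hpp ⊢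
      rw [hpp]
    have hw : (e * star e * x - x) * a * x = 0 := by
      simpa only [sub_mul, mul_assoc, sub_eq_zero] using hpz
    rw [star_sub, star_mul, hp, hx', mul_sub, hw, ← mul_assoc, hw, zero_mul, sub_zero]
  · refine eq_zero_of_forall_mul_mul_star_eq_zero fun a => ?_
    have hz : e * star e * (y * a * y) = 0 := (h0 (mul_mul_mem_innerIdealGen y a)).1
    rw [star_mul, hp, hy', ← mul_assoc, mul_assoc _ y a, mul_assoc _ (y * a) y, hz, zero_mul]
end

section
/- Let a and x be nonzero positive elements of a C*-algebra A. Then the following statements are equivalent: (a) a x = x; (b) a x + x a = 2 x (i.e. the Jordan product a ∘ x equals x); (c) a x a = x. Moreover, if any of these statements holds then a and x commute. -/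
section

variable {A : Type*} [NonUnitalCStarAlgebra A] [PartialOrder A] [StarOrderedRing A]

theorem mul_eq_mul_of_mul_eq_right_of_nonneg {a x : A} (ha : 0 ≤ a) (hx : 0 ≤ x)
    (h : a * x = x) : a * x = x * a := by
  have hs := congrArg star h
  rw [star_mul, (IsSelfAdjoint.of_nonneg ha).star_eq, (IsSelfAdjoint.of_nonneg hx).star_eq] at hs
  rw [h, hs]

theorem mul_eq_right_of_mul_add_mul_eq {a x : A} (hx : 0 ≤ x)
    (h : a * x + x * a = x + x) : a * x = x := by
  have hsq : Commute (x * x) a := by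
    have hl : a * x = x + x - x * a := eq_sub_of_add_eq h
    have hr : x * a = x + x - a * x := eq_sub_of_add_eq' h
    calc x * x * a = x * (x + x - a * x) := by rw [mul_assoc, ← hr]
      _ = (x + x - x * a) * x := by noncomm_ring
      _ = a * (x * x) := by rw [← hl, mul_assoc]
  have hc : Commute x a := by
    have hsqrt : Commute (CFC.sqrt (x * x)) a := hsq.cfcₙ_nnreal _
    rwa [CFC.sqrt_mul_self x hx] at hsqrt
  rw [hc.eq, ← two_smul ℂ (a * x), ← two_smul ℂ x] at h
  exact smul_right_injective A (two_ne_zero (α := ℂ)) h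

theorem mul_eq_right_of_mul_mul_eq {a x : A} (ha : 0 ≤ a) (hx : 0 ≤ x)
    (h : a * x * a = x) : a * x = x := by
  obtain ⟨s, hs, rfl⟩ : ∃ s : A, 0 ≤ s ∧ s * s = x :=
    ⟨CFC.sqrt x, CFC.sqrt_nonneg x, CFC.sqrt_mul_sqrt_self x hx⟩
  have has := (IsSelfAdjoint.of_nonneg ha).star_eq
  have hss := (IsSelfAdjoint.of_nonneg hs).star_eq
  have hsas : s * a * s = s * s := by
    refine (CFC.mul_self_eq_mul_self_iff _ _ (conjugate_nonneg_of_nonneg ha hs) hx).mp ?_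
    calc s * a * s * (s * a * s) = s * (a * (s * s) * a) * s := by simp only [mul_assoc]
      _ = s * s * (s * s) := by rw [h]; simp only [mul_assoc]
  have hsaas : s * a * (a * s) = s * s := by
    have hnonneg : 0 ≤ s * a * (a * s) := by
      simpa only [star_mul, has, hss] using star_mul_self_nonneg (a * s)
    refine (CFC.mul_self_eq_mul_self_iff _ _ hnonneg hx).mp ?_
    calc s * a * (a * s) * (s * a * (a * s)) = s * (a * (a * (s * s) * a) * a) * s := by
          simp only [mul_assoc]
      _ = s * s * (s * s) := by rw [h, h]; simp only [mul_assoc]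
  have hzero : star (a * s - s) * (a * s - s) = 0 := by
    rw [star_sub, star_mul, has, hss, sub_mul, mul_sub, mul_sub, hsaas, hsas, ← mul_assoc s a s,
      hsas]
    simp
  rw [← mul_assoc, sub_eq_zero.mp (CStarRing.star_mul_self_eq_zero_iff _ |>.mp hzero)]

end

/-- Let `a` and `x` be nonzero positive elements of a C*-algebra `A`. Then the following
are equivalent: (a) `a x = x`; (b) `a x + x a = 2 x` (i.e. the Jordan product `a ∘ x`
equals `x`); (c) `a x a = x`. Moreover, if any of these statements holds then `a` and
`x` commute. -/
theorem unit_conditions_equivalent_for_positives {A : Type*} [NonUnitalCStarAlgebra A]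
    [PartialOrder A] [StarOrderedRing A]
    (a x : A) (ha : 0 ≤ a) (ha0 : a ≠ 0) (hx : 0 ≤ x) (hx0 : x ≠ 0) :
    ((a * x = x ↔ a * x + x * a = x + x) ∧
      (a * x = x ↔ a * x * a = x)) ∧
    ((a * x = x ∨ a * x + x * a = x + x ∨ a * x * a = x) → a * x = x * a) := by
  have hcomm : a * x = x → a * x = x * a := mul_eq_mul_of_mul_eq_right_of_nonneg ha hx
  have hb : a * x + x * a = x + x → a * x = x := mul_eq_right_of_mul_add_mul_eq hx
  have hc : a * x * a = x → a * x = x := mul_eq_right_of_mul_mul_eq ha hx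
  refine ⟨⟨⟨fun h ↦ ?_, hb⟩, ⟨fun h ↦ ?_, hc⟩⟩, ?_⟩
  · rw [← hcomm h, h]
  · rw [h, ← hcomm h, h]
  · rintro (h | h | h)
    exacts [hcomm h, hcomm (hb h), hcomm (hc h)]
end

section
/- Let a and x be positive elements of a C*-algebra A with a x + x a = 2 x. Then a z = z a = z for every z in the norm closure of {x b x : b ∈ A} (the inner ideal of A generated by x). -/
/-- Let `a` and `x` be positive elements of a C*-algebra `A` with `a ∘ x = x`, i.e.
`a x + x a = 2 x`. Then `a z = z a = z` for every `z` in the norm closure of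
`{x b x : b ∈ A}`, the inner ideal of `A` generated by `x`. -/
theorem jordan_unit_extends_to_inner_ideal {A : Type*} [NonUnitalCStarAlgebra A]
    [PartialOrder A] [StarOrderedRing A]
    (a x : A) (ha : 0 ≤ a) (hx : 0 ≤ x) (h : a * x + x * a = x + x) :
    ∀ z ∈ closure {w : A | ∃ b : A, w = x * b * x}, a * z = z ∧ z * a = z := by
  have hax : a * x = x + x - x * a := eq_sub_of_add_eq h
  have hsq : Commute (x * x) a := by
    have : a * (x * x) = x * x * a := by
      rw [← mul_assoc, hax, sub_mul, mul_assoc x a x, hax]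
      noncomm_ring
    exact this.symm
  have hcomm : Commute x a := by
    rw [← CFC.sqrt_mul_self x hx]
    exact hsq.cfcₙ_nnreal _
  have hdouble : (2 : ℂ) • (a * x) = (2 : ℂ) • x := by
    rw [two_smul, two_smul, ← h, hcomm.eq]
  have hleft : a * x = x := smul_right_injective A two_ne_zero hdouble
  have hright : x * a = x := hcomm.eq.trans hleft
  have hclosed : IsClosed {z : A | a * z = z ∧ z * a = z} :=
    (isClosed_eq (by fun_prop) continuous_id).inter (isClosed_eq (by fun_prop) continuous_id)
  refine fun z hz ↦ closure_minimal ?_ hclosed hz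
  rintro _ ⟨b, rfl⟩
  exact ⟨by rw [← mul_assoc, ← mul_assoc, hleft], by rw [mul_assoc, hright]⟩
end

section
/- Let A be an AW*-algebra and let B and C be hereditary C*-subalgebras of A with b c = 0 and c b = 0 for all b ∈ B and c ∈ C. Then there exists a projection p ∈ A such that p b = b p = b for all b ∈ B and p c = c p = 0 for all c ∈ C. -/
/-- A C*-algebra is an AW*-algebra if the right annihilator of every nonempty subset is
of the form `p A` for a projection `p`. -/
def IsAWStar (A : Type*) [CStarAlgebra A] : Prop :=
  ∀ S : Set A, S.Nonempty → ∃ p : A, IsProjection p ∧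
    {y : A | ∀ s ∈ S, s * y = 0} = {z : A | ∃ a : A, z = p * a}

/-- A hereditary C*-subalgebra: a norm-closed *-subalgebra `C` such that `0 ≤ a ≤ b`
with `b ∈ C` implies `a ∈ C`. -/
def IsHereditary {A : Type*} [CStarAlgebra A] [PartialOrder A]
    (C : NonUnitalStarSubalgebra ℂ A) : Prop :=
  IsClosed (C : Set A) ∧ ∀ a b : A, 0 ≤ a → a ≤ b → b ∈ C → a ∈ C

/-- Let `A` be an AW*-algebra and let `B` and `C` be orthogonal hereditary
C*-subalgebras of `A` (all mutual products vanish). Then there is a projection `p ∈ A`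
which is a unit for `B` and annihilates `C`. -/
theorem awstar_projection_unit_for_hereditary {A : Type*}
    [CStarAlgebra A] [PartialOrder A] [StarOrderedRing A]
    (hA : IsAWStar A)
    (B C : NonUnitalStarSubalgebra ℂ A) (hB : IsHereditary B) (hC : IsHereditary C)
    (horth : ∀ b ∈ B, ∀ c ∈ C, b * c = 0 ∧ c * b = 0) :
    ∃ p : A, IsProjection p ∧
      (∀ b ∈ B, p * b = b ∧ b * p = b) ∧
      (∀ c ∈ C, p * c = 0 ∧ c * p = 0) := by
  obtain ⟨p, hp, hann⟩ := hA C ⟨0, C.zero_mem⟩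
  have hpB : ∀ b ∈ B, p * b = b := fun b hb => by
    obtain ⟨a, rfl⟩ : b ∈ {z : A | ∃ a : A, z = p * a} :=
      hann ▸ fun c hc => (horth b hb c hc).2
    rw [← mul_assoc, hp.2]
  have hCp : ∀ c ∈ C, c * p = 0 := by
    have h : p ∈ {y : A | ∀ s ∈ (C : Set A), s * y = 0} := hann ▸ ⟨1, (mul_one p).symm⟩
    exact h
  refine ⟨p, hp, fun b hb => ⟨hpB b hb, ?_⟩, fun c hc => ⟨?_, hCp c hc⟩⟩
  · simpa [hp.1] using congrArg star (hpB (star b) (star_mem hb))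
  · simpa [hp.1] using congrArg star (hCp (star c) (star_mem hc))
end
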